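/- The value function V(t,m) = inf_{M ∈ 𝓜(t,m)} E[∫_t^T H(s,M_s) ds] is a viscosity subsolution of the Hamilton–Jacobi equation ∂_t U(t,m) + (1/2) ∫_{ℝ^d} div[D_m U](t,m,x) dm(x) + H(t,m) = 0 on [0,T) × 𝒫₂: for every (t,m) ∈ [0,T) × 𝒫₂ and every test function φ satisfying (A3) such that φ − V has a local minimum at (t,m), one has ∂_t φ(t,m) + (1/2) ∫_{ℝ^d} div[D_m φ](t,m,x) dm(x) + H(t,m) ≥ 0. -/

import Mathlib

open MeasureTheory Filter Set
open scoped Topology ENNReal NNReal BoundedContinuousFunction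

noncomputable section

/-- Euclidean space `ℝ^d`. -/
abbrev Ed (d : ℕ) : Type := EuclideanSpace ℝ (Fin d)

/-- `m ∈ 𝒫_p` : Borel probability measure on `ℝ^d` with finite `p`-th moment. -/
def MemP (d : ℕ) (p : ℝ) (m : Measure (Ed d)) : Prop :=
  IsProbabilityMeasure m ∧ Integrable (fun x => ‖x‖ ^ p) m

/-- `γ` is a coupling of `m` and `m'`. -/
def IsCoupling (d : ℕ) (γ : Measure (Ed d × Ed d)) (m m' : Measure (Ed d)) : Prop :=
  γ.map Prod.fst = m ∧ γ.map Prod.snd = m'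

/-- The `p`-Wasserstein distance. -/
def wdist (d : ℕ) (p : ℝ) (m m' : Measure (Ed d)) : ℝ :=
  sInf { c : ℝ | ∃ γ : Measure (Ed d × Ed d), IsProbabilityMeasure γ ∧ IsCoupling d γ m m' ∧
      c = (∫ q, ‖q.1 - q.2‖ ^ p ∂γ) ^ (1 / p) }

/-- The Gaussian kernel `ρ_δ`. -/
def gaussDensity (d : ℕ) (δ : ℝ) (x : Ed d) : ℝ :=
  (2 * Real.pi * δ) ^ (-(d : ℝ) / 2) * Real.exp (-‖x‖ ^ 2 / (2 * δ))

/-- The centered Gaussian measure with variance `δ` on `ℝ^d`. -/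
def gaussMeasure (d : ℕ) (δ : ℝ) : Measure (Ed d) :=
  volume.withDensity fun x => ENNReal.ofReal (gaussDensity d δ x)

/-- The heat flow `p^{t,m}_s` : the law at time `s` of a Brownian motion started
at time `t` with initial law `m`. -/
def heatFlow (d : ℕ) (t s : ℝ) (m : Measure (Ed d)) : Measure (Ed d) :=
  if s ≤ t then m
  else Measure.map (fun q : Ed d × Ed d => q.1 + q.2) (m.prod (gaussMeasure d (s - t)))

/-- The natural filtration of a measure-valued process, made right-continuous:
`𝓕^M_s = ⋂_{u > s} σ(M_r, r ∈ [t,u])`. -/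
def genFiltration {Ω : Type} (d : ℕ) (M : ℝ → Ω → Measure (Ed d)) (t s : ℝ) :
    MeasurableSpace Ω :=
  ⨅ u ∈ Set.Ioi s, ⨆ r ∈ Set.Icc t u, MeasurableSpace.comap (M r) inferInstance

/-- A path `[t,T] → (𝒫₁,d₁)` is càdlàg: right-continuous with left limits (for `d₁`). -/
def CadlagD1 (d : ℕ) (t T : ℝ) (g : ℝ → Measure (Ed d)) : Prop :=
  (∀ s ∈ Set.Ico t T, Tendsto (fun r => wdist d 1 (g r) (g s)) (𝓝[Set.Ici s] s) (𝓝 0)) ∧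
  (∀ s ∈ Set.Ioc t T, ∃ μ : Measure (Ed d),
      Tendsto (fun r => wdist d 1 (g r) μ) (𝓝[Set.Ico t s] s) (𝓝 0))

/-- An element of `𝓜(t,m)` : a càdlàg `(𝒫₁,d₁)`-valued process `M = (M_s)_{s∈[t,T]}`
on some probability space such that (i) `E[M_t(φ)] = m(φ)` for all bounded continuous `φ`
and (ii) `E[M_{t₂}(φ) | 𝓕^M_{t₁}] = p^{t₁,M_{t₁}}_{t₂}(φ)` for all `t ≤ t₁ ≤ t₂ ≤ T` and
all bounded continuous `φ`. -/
structure MVP (d : ℕ) (T t : ℝ) (m : Measure (Ed d)) where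
  Ω : Type
  mΩ : MeasurableSpace Ω
  P : @Measure Ω mΩ
  probP : IsProbabilityMeasure P
  M : ℝ → Ω → Measure (Ed d)
  meas : ∀ s, @Measurable Ω (Measure (Ed d)) mΩ inferInstance (M s)
  inP1 : ∀ s ∈ Set.Icc t T, ∀ ω, MemP d 1 (M s ω)
  cadlag : ∀ ω, CadlagD1 d t T (fun s => M s ω)
  init : ∀ φ : Ed d →ᵇ ℝ, ∫ ω, (∫ x, φ x ∂(M t ω)) ∂P = ∫ x, φ x ∂m
  cond : ∀ t₁ t₂ : ℝ, t ≤ t₁ → t₁ ≤ t₂ → t₂ ≤ T → ∀ φ : Ed d →ᵇ ℝ,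
    P[(fun ω => ∫ x, φ x ∂(M t₂ ω)) | genFiltration d M t t₁]
      =ᵐ[P] fun ω => ∫ x, φ x ∂(heatFlow d t₁ t₂ (M t₁ ω))
/-- The Hamiltonian `H(t,m) = inf_u sup_v ∫ f(t,x,u,v) dm(x)`. -/
def hamiltonian {d : ℕ} {A B : Type} (f : ℝ → Ed d → A → B → ℝ)
    (t : ℝ) (m : Measure (Ed d)) : ℝ :=
  ⨅ u : A, ⨆ v : B, ∫ x, f t x u v ∂m

/-- The cost `E[∫_t^T H(s, M_s) ds]` of a measure-valued process. -/
def mvCost {d : ℕ} {A B : Type} (f : ℝ → Ed d → A → B → ℝ)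
    {T t : ℝ} {m : Measure (Ed d)} (X : MVP d T t m) : ℝ :=
  ∫ ω, (∫ s in Set.Icc t T, hamiltonian f s (X.M s ω)) ∂X.P

/-- The value function `V(t,m) = inf_{M ∈ 𝓜(t,m)} E[∫_t^T H(s, M_s) ds]`. -/
def gameValue (d : ℕ) {A B : Type} (f : ℝ → Ed d → A → B → ℝ)
    (T t : ℝ) (m : Measure (Ed d)) : ℝ :=
  sInf { r : ℝ | ∃ X : MVP d T t m, r = mvCost f X }
/-- The Laplacian of a function on `ℝ^d` (the spatial divergence of its gradient),
`div[∇g](x) = Σ_i ∂²g/∂x_i²(x)`. -/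
def lapl (d : ℕ) (g : Ed d → ℝ) (x : Ed d) : ℝ :=
  ∑ i : Fin d, iteratedFDeriv ℝ 2 g x (fun _ => EuclideanSpace.single i (1:ℝ))

/-- A test function satisfying condition (A3): `φ` is lower semicontinuous (for `d₁`) and
`d₂`-continuous, the derivatives `∂φ/∂t`, `δφ/δm`, `∇_x(δφ/δm)`, `∇²_x(δφ/δm)` exist and
are `d₂`-continuous on `[0,T) × 𝒫₂ × ℝ^d`, and `δφ/δm` and its first and second spatial
derivatives have at most quadratic growth in `x`, uniformly in `(t,m)`. -/
structure TestFn (d : ℕ) (T : ℝ) where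
  /-- the test function `φ(t,m)` -/
  φ : ℝ → Measure (Ed d) → ℝ
  /-- the time derivative `∂φ/∂t` -/
  φt : ℝ → Measure (Ed d) → ℝ
  /-- the linear functional derivative `δφ/δm (t,m,x)` -/
  δφ : ℝ → Measure (Ed d) → Ed d → ℝ
  lsc : ∀ t ∈ Set.Icc 0 T, ∀ m : Measure (Ed d), MemP d 2 m → ∀ ε > (0:ℝ), ∃ η > (0:ℝ),
    ∀ t' ∈ Set.Icc 0 T, ∀ m' : Measure (Ed d), MemP d 2 m' →
      |t' - t| < η → wdist d 1 m m' < η → φ t m - ε < φ t' m'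
  d2cont : ∀ t ∈ Set.Icc 0 T, ∀ m : Measure (Ed d), MemP d 2 m → ∀ ε > (0:ℝ), ∃ η > (0:ℝ),
    ∀ t' ∈ Set.Icc 0 T, ∀ m' : Measure (Ed d), MemP d 2 m' →
      |t' - t| < η → wdist d 2 m m' < η → |φ t' m' - φ t m| < ε
  timeDeriv : ∀ m : Measure (Ed d), MemP d 2 m → ∀ t ∈ Set.Ico 0 T,
    HasDerivWithinAt (fun s => φ s m) (φt t m) (Set.Icc 0 T) t
  measDeriv : ∀ t ∈ Set.Ico 0 T, ∀ m : Measure (Ed d), MemP d 2 m →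
    ∀ m' : Measure (Ed d), MemP d 2 m' →
      Tendsto (fun r : ℝ =>
          (φ t ((1 - ENNReal.ofReal r) • m + ENNReal.ofReal r • m') - φ t m) / r)
        (𝓝[>] 0) (𝓝 (∫ x, δφ t m x ∂m'))
  normalized : ∀ t ∈ Set.Ico 0 T, ∀ m : Measure (Ed d), MemP d 2 m →
    ∫ x, δφ t m x ∂m = 0
  smoothX : ∀ t ∈ Set.Ico 0 T, ∀ m : Measure (Ed d), MemP d 2 m → ContDiff ℝ 2 (δφ t m)
  quadGrowth : ∃ c : ℝ, ∀ t ∈ Set.Ico 0 T, ∀ m : Measure (Ed d), MemP d 2 m → ∀ x : Ed d,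
    |δφ t m x| ≤ c * (1 + ‖x‖ ^ 2) ∧ ‖fderiv ℝ (δφ t m) x‖ ≤ c * (1 + ‖x‖ ^ 2) ∧
      ‖iteratedFDeriv ℝ 2 (δφ t m) x‖ ≤ c * (1 + ‖x‖ ^ 2)
  d2contDeriv : ∀ t ∈ Set.Ico 0 T, ∀ m : Measure (Ed d), MemP d 2 m → ∀ x : Ed d,
    ∀ ε > (0:ℝ), ∃ η > (0:ℝ), ∀ t' ∈ Set.Ico 0 T, ∀ m' : Measure (Ed d), MemP d 2 m' →
      ∀ x' : Ed d, |t' - t| < η → wdist d 2 m m' < η → ‖x' - x‖ < η →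
        |φt t' m' - φt t m| < ε ∧ |δφ t' m' x' - δφ t m x| < ε ∧
          ‖fderiv ℝ (δφ t' m') x' - fderiv ℝ (δφ t m) x‖ < ε ∧
          ‖iteratedFDeriv ℝ 2 (δφ t' m') x' - iteratedFDeriv ℝ 2 (δφ t m) x‖ < ε

/-- `φ − u` has a local minimum at `(t,m)` (locality for `|·|` in time and `d₁` in measure). -/
def LocalMinAt (d : ℕ) (T : ℝ) (g : ℝ → Measure (Ed d) → ℝ)
    (t : ℝ) (m : Measure (Ed d)) : Prop :=
  ∃ η > (0:ℝ), ∀ t' ∈ Set.Icc 0 T, ∀ m' : Measure (Ed d), MemP d 2 m' →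
    |t' - t| ≤ η → wdist d 1 m m' ≤ η → g t m ≤ g t' m'

/-- `u` is a (viscosity) subsolution on `[0,T) × 𝒫₂` of the Hamilton-Jacobi equation
`∂_t U(t,m) + ½ ∫ div[D_m U](t,m,x) dm(x) + F(t,m) = 0` : for every `(t,m) ∈ [0,T) × 𝒫₂`
and every test function `φ` satisfying (A3) such that `φ − u` has a local minimum at
`(t,m)`, one has `∂_t φ(t,m) + ½ ∫ div[D_m φ](t,m,x) dm(x) + F(t,m) ≥ 0`. -/
def IsSubsolution (d : ℕ) (T : ℝ) (F : ℝ → Measure (Ed d) → ℝ)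
    (u : ℝ → Measure (Ed d) → ℝ) : Prop :=
  ∀ t ∈ Set.Ico 0 T, ∀ m : Measure (Ed d), MemP d 2 m → ∀ ψ : TestFn d T,
    LocalMinAt d T (fun s μ => ψ.φ s μ - u s μ) t m →
      ψ.φt t m + (1 / 2) * (∫ x, lapl d (ψ.δφ t m) x ∂m) + F t m ≥ 0

/-- `u : [0,T] × 𝒫₂ → ℝ` is (jointly) continuous for the distance `|·| + d₁`. -/
def ContD1 (d : ℕ) (T : ℝ) (u : ℝ → Measure (Ed d) → ℝ) : Prop :=
  ∀ t ∈ Set.Icc 0 T, ∀ m : Measure (Ed d), MemP d 2 m → ∀ ε > (0:ℝ), ∃ η > (0:ℝ),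
    ∀ t' ∈ Set.Icc 0 T, ∀ m' : Measure (Ed d), MemP d 2 m' →
      |t' - t| < η → wdist d 1 m m' < η → |u t' m' - u t m| < ε

/-- `u : [0,T] × 𝒫₂ → ℝ` is bounded. -/
def BddD1 (d : ℕ) (T : ℝ) (u : ℝ → Measure (Ed d) → ℝ) : Prop :=
  ∃ c : ℝ, ∀ t ∈ Set.Icc 0 T, ∀ m : Measure (Ed d), MemP d 2 m → |u t m| ≤ c

/-- The data of condition (A1) for a source term `F` : `F` is bounded and continuous, and
`δF/δm`, `∇_x(δF/δm)`, `∇²_x(δF/δm)` exist and are bounded and continuous. -/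
structure A1Data (d : ℕ) (T : ℝ) where
  /-- the source term `F(t,m)` -/
  F : ℝ → Measure (Ed d) → ℝ
  /-- the linear functional derivative `δF/δm (t,m,x)` -/
  δF : ℝ → Measure (Ed d) → Ed d → ℝ
  bddF : BddD1 d T F
  contF : ContD1 d T F
  measDeriv : ∀ t ∈ Set.Icc 0 T, ∀ m : Measure (Ed d), MemP d 2 m →
    ∀ m' : Measure (Ed d), MemP d 2 m' →
      Tendsto (fun r : ℝ =>
          (F t ((1 - ENNReal.ofReal r) • m + ENNReal.ofReal r • m') - F t m) / r)
        (𝓝[>] 0) (𝓝 (∫ x, δF t m x ∂m'))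
  normalized : ∀ t ∈ Set.Icc 0 T, ∀ m : Measure (Ed d), MemP d 2 m →
    ∫ x, δF t m x ∂m = 0
  smoothX : ∀ t ∈ Set.Icc 0 T, ∀ m : Measure (Ed d), MemP d 2 m → ContDiff ℝ 2 (δF t m)
  bddDeriv : ∃ c : ℝ, ∀ t ∈ Set.Icc 0 T, ∀ m : Measure (Ed d), MemP d 2 m → ∀ x : Ed d,
    |δF t m x| ≤ c ∧ ‖fderiv ℝ (δF t m) x‖ ≤ c ∧ ‖iteratedFDeriv ℝ 2 (δF t m) x‖ ≤ c
  contDeriv : ∀ t ∈ Set.Icc 0 T, ∀ m : Measure (Ed d), MemP d 2 m → ∀ x : Ed d,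
    ∀ ε > (0:ℝ), ∃ η > (0:ℝ), ∀ t' ∈ Set.Icc 0 T, ∀ m' : Measure (Ed d), MemP d 2 m' →
      ∀ x' : Ed d, |t' - t| < η → wdist d 1 m m' < η → ‖x' - x‖ < η →
        |δF t' m' x' - δF t m x| < ε ∧
          ‖fderiv ℝ (δF t' m') x' - fderiv ℝ (δF t m) x‖ < ε ∧
          ‖iteratedFDeriv ℝ 2 (δF t' m') x' - iteratedFDeriv ℝ 2 (δF t m) x‖ < ε

/-- The data of condition (A2) for a terminal condition `ψ` : `ψ` is continuous with at
most linear growth, and `δψ/δm`, `∇_x(δψ/δm)`, `∇²_x(δψ/δm)` exist, are continuous, and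
have linear growth in `x` uniformly in `m`. -/
structure A2Data (d : ℕ) where
  /-- the terminal condition `ψ(m)` -/
  ψ : Measure (Ed d) → ℝ
  /-- the linear functional derivative `δψ/δm (m,x)` -/
  δψ : Measure (Ed d) → Ed d → ℝ
  growth : ∃ c : ℝ, ∀ m : Measure (Ed d), MemP d 2 m → |ψ m| ≤ c * (1 + ∫ x, ‖x‖ ∂m)
  contψ : ∀ m : Measure (Ed d), MemP d 2 m → ∀ ε > (0:ℝ), ∃ η > (0:ℝ),
    ∀ m' : Measure (Ed d), MemP d 2 m' → wdist d 1 m m' < η → |ψ m' - ψ m| < ε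
  measDeriv : ∀ m : Measure (Ed d), MemP d 2 m → ∀ m' : Measure (Ed d), MemP d 2 m' →
    Tendsto (fun r : ℝ =>
        (ψ ((1 - ENNReal.ofReal r) • m + ENNReal.ofReal r • m') - ψ m) / r)
      (𝓝[>] 0) (𝓝 (∫ x, δψ m x ∂m'))
  normalized : ∀ m : Measure (Ed d), MemP d 2 m → ∫ x, δψ m x ∂m = 0
  smoothX : ∀ m : Measure (Ed d), MemP d 2 m → ContDiff ℝ 2 (δψ m)
  derivGrowth : ∃ c : ℝ, ∀ m : Measure (Ed d), MemP d 2 m → ∀ x : Ed d,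
    |δψ m x| ≤ c * (1 + ‖x‖) ∧ ‖fderiv ℝ (δψ m) x‖ ≤ c * (1 + ‖x‖) ∧
      ‖iteratedFDeriv ℝ 2 (δψ m) x‖ ≤ c * (1 + ‖x‖)
  contDeriv : ∀ m : Measure (Ed d), MemP d 2 m → ∀ x : Ed d, ∀ ε > (0:ℝ), ∃ η > (0:ℝ),
    ∀ m' : Measure (Ed d), MemP d 2 m' → ∀ x' : Ed d,
      wdist d 1 m m' < η → ‖x' - x‖ < η →
        |δψ m' x' - δψ m x| < ε ∧ ‖fderiv ℝ (δψ m') x' - fderiv ℝ (δψ m) x‖ < ε ∧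
          ‖iteratedFDeriv ℝ 2 (δψ m') x' - iteratedFDeriv ℝ 2 (δψ m) x‖ < ε

/-- The centered Gaussian measure with variance `δ` as a dilation of the standard one. -/
def scaledGaussian (d : ℕ) (δ : ℝ) : Measure (Ed d) :=
  (ProbabilityTheory.stdGaussian (Ed d)).map fun z => √δ • z

instance (d : ℕ) (δ : ℝ) : IsProbabilityMeasure (scaledGaussian d δ) :=
  Measure.isProbabilityMeasure_map (by fun_prop)

lemma charFun_scaledGaussian (d : ℕ) {δ : ℝ} (hδ : 0 ≤ δ) (ξ : Ed d) :
    charFun (scaledGaussian d δ) ξ = Complex.exp (-(δ * ‖ξ‖ ^ 2 / 2)) := by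
  rw [scaledGaussian, charFun_map_smul, ProbabilityTheory.charFun_stdGaussian, norm_smul,
    Real.norm_of_nonneg (Real.sqrt_nonneg _), Complex.ofReal_mul, mul_pow, ← Complex.ofReal_pow,
    Real.sq_sqrt hδ]
  ring_nf

lemma integrable_gaussDensity (d : ℕ) {δ : ℝ} (hδ : 0 < δ) : Integrable (gaussDensity d δ) := by
  have h := GaussianFourier.integrable_cexp_neg_mul_sq_norm_add (V := Ed d)
    (b := ((1 / (2 * δ) : ℝ) : ℂ)) (by rw [Complex.ofReal_re]; positivity) 0 0
  have h2 := h.re.const_mul ((2 * Real.pi * δ) ^ (-(d : ℝ) / 2))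
  refine h2.congr (ae_of_all _ fun x => ?_)
  simp only [gaussDensity]
  congr 1
  have : -((1 / (2 * δ) : ℝ) : ℂ) * (‖x‖ : ℂ) ^ 2 + 0 * (inner ℝ (0 : Ed d) x : ℝ)
      = ((-‖x‖ ^ 2 / (2 * δ) : ℝ) : ℂ) := by
    push_cast; ring
  rw [this, ← Complex.ofReal_exp]
  rfl

lemma gaussDensity_nonneg (d : ℕ) {δ : ℝ} (hδ : 0 < δ) (x : Ed d) : 0 ≤ gaussDensity d δ x := by
  unfold gaussDensity; positivity

lemma gaussMeasure_eq_scaledGaussian (d : ℕ) {δ : ℝ} (hδ : 0 < δ) :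
    gaussMeasure d δ = scaledGaussian d δ := by
  have hi := integrable_gaussDensity d hδ
  have : IsFiniteMeasure (gaussMeasure d δ) :=
    isFiniteMeasure_withDensity_ofReal hi.hasFiniteIntegral
  refine Measure.ext_of_charFun (funext fun ξ => ?_)
  rw [charFun_scaledGaussian d hδ.le, charFun_apply, gaussMeasure,
    integral_withDensity_eq_integral_toReal_smul₀ hi.1.aemeasurable.ennreal_ofReal
      (ae_of_all _ fun _ => ENNReal.ofReal_lt_top)]
  have key := GaussianFourier.integral_cexp_neg_mul_sq_norm_add (V := Ed d)
    (b := ((1 / (2 * δ) : ℝ) : ℂ)) (by rw [Complex.ofReal_re]; positivity) Complex.I ξ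
  have : ∀ x : Ed d, (ENNReal.ofReal (gaussDensity d δ x)).toReal •
      Complex.exp ((inner ℝ x ξ : ℝ) * Complex.I) =
      (((2 * Real.pi * δ) ^ (-(d : ℝ) / 2) : ℝ) : ℂ) *
      Complex.exp (-((1 / (2 * δ) : ℝ) : ℂ) * (‖x‖ : ℂ) ^ 2
        + Complex.I * (inner ℝ ξ x : ℝ)) := by
    intro x
    rw [ENNReal.toReal_ofReal (gaussDensity_nonneg d hδ x), gaussDensity, Complex.real_smul,
      Complex.exp_add, Complex.ofReal_mul, mul_assoc, real_inner_comm x ξ, Complex.ofReal_exp]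
    congr 2
    · congr 1; push_cast; ring
    · rw [mul_comm]
  simp_rw [this]
  rw [integral_const_mul, key, ← mul_assoc]
  have hpos : 0 < 2 * Real.pi * δ := by positivity
  have h1 : (Real.pi : ℂ) / ((1 / (2 * δ) : ℝ) : ℂ) = ((2 * Real.pi * δ : ℝ) : ℂ) := by
    have : (δ : ℂ) ≠ 0 := by exact_mod_cast hδ.ne'
    push_cast; field_simp
  have h2 : (((2 * Real.pi * δ) ^ (-(d : ℝ) / 2) : ℝ) : ℂ) *
      ((Real.pi : ℂ) / ((1 / (2 * δ) : ℝ) : ℂ)) ^ ((Module.finrank ℝ (Ed d) : ℂ) / 2) = 1 := by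
    rw [h1, show ((Module.finrank ℝ (Ed d) : ℂ) / 2) = (((d : ℝ) / 2 : ℝ) : ℂ) by simp,
      ← Complex.ofReal_cpow hpos.le, ← Complex.ofReal_mul, ← Real.rpow_add hpos]
    simp [neg_div]
  rw [h2, one_mul]
  congr 1
  have : (δ : ℂ) ≠ 0 := by exact_mod_cast hδ.ne'
  rw [Complex.I_sq]
  push_cast
  field_simp
  ring

lemma scaledGaussian_zero (d : ℕ) : scaledGaussian d 0 = Measure.dirac 0 := by
  simp [scaledGaussian, Measure.map_const]

lemma scaledGaussian_conv (d : ℕ) {a b : ℝ} (ha : 0 ≤ a) (hb : 0 ≤ b) :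
    (scaledGaussian d a).conv (scaledGaussian d b) = scaledGaussian d (a + b) := by
  refine Measure.ext_of_charFun (funext fun ξ => ?_)
  rw [charFun_conv, charFun_scaledGaussian d ha, charFun_scaledGaussian d hb,
    charFun_scaledGaussian d (add_nonneg ha hb), ← Complex.exp_add]
  push_cast; ring_nf

lemma heatFlow_eq_conv (d : ℕ) {t s : ℝ} (h : t ≤ s) (m : Measure (Ed d)) [SFinite m] :
    heatFlow d t s m = m.conv (scaledGaussian d (s - t)) := by
  unfold heatFlow
  split_ifs with h'
  · obtain rfl : s = t := le_antisymm h' h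
    rw [sub_self, scaledGaussian_zero, Measure.conv_dirac_zero]
  · rw [gaussMeasure_eq_scaledGaussian d (by linarith)]
    rfl

lemma heatFlow_self (d : ℕ) (t : ℝ) (m : Measure (Ed d)) : heatFlow d t t m = m := by
  simp [heatFlow]

/-- The heat flow as the law of `x + √(s - t) z`. -/
lemma heatFlow_eq_map (d : ℕ) {t s : ℝ} (h : t ≤ s) (m : Measure (Ed d)) [SFinite m] :
    heatFlow d t s m = (m.prod (ProbabilityTheory.stdGaussian (Ed d))).map
      fun q => q.1 + √(s - t) • q.2 := by
  rw [heatFlow_eq_conv d h, Measure.conv, scaledGaussian]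
  conv_lhs => rw [← Measure.map_id (μ := m)]
  rw [Measure.map_prod_map _ _ measurable_id (by fun_prop),
    Measure.map_map (by fun_prop) (by fun_prop)]
  rfl

lemma isProbabilityMeasure_heatFlow (d : ℕ) {t s : ℝ} (h : t ≤ s) (m : Measure (Ed d))
    [IsProbabilityMeasure m] : IsProbabilityMeasure (heatFlow d t s m) := by
  rw [heatFlow_eq_conv d h]; infer_instance

lemma heatFlow_heatFlow (d : ℕ) {t s r : ℝ} (h : t ≤ s) (h' : s ≤ r) (m : Measure (Ed d))
    [IsProbabilityMeasure m] : heatFlow d s r (heatFlow d t s m) = heatFlow d t r m := by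
  have := isProbabilityMeasure_heatFlow d h m
  rw [heatFlow_eq_conv d h', heatFlow_eq_conv d h, heatFlow_eq_conv d (h.trans h'),
    Measure.conv_assoc, scaledGaussian_conv d (by linarith) (by linarith)]
  congr 2; ring

/-- Integration against the heat flow at time `s` of a bounded continuous function, as
integration of the smoothed function. -/
lemma exists_integral_heatFlow_eq (d : ℕ) {t s : ℝ} (h : t ≤ s) (φ : Ed d →ᵇ ℝ) :
    ∃ φ' : Ed d →ᵇ ℝ, ∀ m : Measure (Ed d), IsProbabilityMeasure m →
      ∫ x, φ x ∂(heatFlow d t s m) = ∫ x, φ' x ∂m := by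
  have hint : ∀ x : Ed d, Integrable (fun z => φ (x + √(s - t) • z))
      (ProbabilityTheory.stdGaussian (Ed d)) := fun x =>
    Integrable.of_bound (by fun_prop : Continuous _).aestronglyMeasurable ‖φ‖
      (ae_of_all _ fun z => φ.norm_coe_le_norm _)
  have hc : Continuous fun x : Ed d =>
      ∫ z, φ (x + √(s - t) • z) ∂(ProbabilityTheory.stdGaussian (Ed d)) :=
    continuous_of_dominated (bound := fun _ => ‖φ‖)
      (fun x => (hint x).1) (fun x => ae_of_all _ fun z => φ.norm_coe_le_norm _)
      (integrable_const _) (ae_of_all _ fun z => by fun_prop)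
  refine ⟨BoundedContinuousFunction.ofNormedAddCommGroup _ hc ‖φ‖ fun x => ?_, fun m hm => ?_⟩
  · refine (norm_integral_le_of_norm_le_const
      (ae_of_all _ fun z => φ.norm_coe_le_norm _)).trans ?_
    simp
  · rw [heatFlow_eq_map d h, integral_map (by fun_prop)
      φ.continuous.aestronglyMeasurable, integral_prod]
    · rfl
    · exact Integrable.of_bound (by fun_prop : Continuous _).aestronglyMeasurable ‖φ‖
        (ae_of_all _ fun z => φ.norm_coe_le_norm _)

lemma bddBelow_wdist (d : ℕ) (p : ℝ) (m m' : Measure (Ed d)) :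
    BddBelow { c : ℝ | ∃ γ : Measure (Ed d × Ed d), IsProbabilityMeasure γ ∧ IsCoupling d γ m m' ∧
      c = (∫ q, ‖q.1 - q.2‖ ^ p ∂γ) ^ (1 / p) } := by
  refine ⟨0, ?_⟩
  rintro _ ⟨γ, -, -, rfl⟩
  exact Real.rpow_nonneg (integral_nonneg fun q => Real.rpow_nonneg (norm_nonneg _) _) _

lemma wdist_nonneg (d : ℕ) (p : ℝ) (m m' : Measure (Ed d)) : 0 ≤ wdist d p m m' := by
  refine Real.sInf_nonneg ?_
  rintro _ ⟨γ, -, -, rfl⟩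
  exact Real.rpow_nonneg (integral_nonneg fun q => Real.rpow_nonneg (norm_nonneg _) _) _

lemma wdist_le {d : ℕ} {p : ℝ} {m m' : Measure (Ed d)} {γ : Measure (Ed d × Ed d)}
    [IsProbabilityMeasure γ] (hγ : IsCoupling d γ m m') :
    wdist d p m m' ≤ (∫ q, ‖q.1 - q.2‖ ^ p ∂γ) ^ (1 / p) :=
  csInf_le (bddBelow_wdist d p m m') ⟨γ, inferInstance, hγ, rfl⟩

lemma wdist_le_comm (d : ℕ) (p : ℝ) (m m' : Measure (Ed d)) [IsProbabilityMeasure m]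
    [IsProbabilityMeasure m'] : wdist d p m m' ≤ wdist d p m' m := by
  refine le_csInf ⟨_, m'.prod m, inferInstance, ⟨by simp, by simp⟩, rfl⟩ ?_
  rintro _ ⟨γ, hγ, ⟨h1, h2⟩, rfl⟩
  have : IsProbabilityMeasure (γ.map Prod.swap) :=
    Measure.isProbabilityMeasure_map (by fun_prop)
  have hc : IsCoupling d (γ.map Prod.swap) m m' := by
    constructor
    · rw [Measure.map_map (by fun_prop) (by fun_prop)]; exact h2
    · rw [Measure.map_map (by fun_prop) (by fun_prop)]; exact h1
  refine (wdist_le hc).trans (le_of_eq ?_)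
  have hm : AEStronglyMeasurable (fun q : Ed d × Ed d => ‖q.1 - q.2‖ ^ p) (γ.map Prod.swap) :=
    Measurable.aestronglyMeasurable (by fun_prop)
  rw [integral_map (by fun_prop) hm]
  simp [norm_sub_rev]

lemma wdist_comm (d : ℕ) (p : ℝ) (m m' : Measure (Ed d)) [IsProbabilityMeasure m]
    [IsProbabilityMeasure m'] : wdist d p m m' = wdist d p m' m :=
  (wdist_le_comm d p m m').antisymm (wdist_le_comm d p m' m)

/-- The joint law of `(x + a z, x + b z)`, for `x` of law `m` and `z` standard Gaussian. -/
def heatCoupling (d : ℕ) (m : Measure (Ed d)) (a b : ℝ) : Measure (Ed d × Ed d) :=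
  (m.prod (ProbabilityTheory.stdGaussian (Ed d))).map
    fun q => (q.1 + a • q.2, q.1 + b • q.2)

instance (d : ℕ) (m : Measure (Ed d)) [IsProbabilityMeasure m] (a b : ℝ) :
    IsProbabilityMeasure (heatCoupling d m a b) :=
  Measure.isProbabilityMeasure_map (by fun_prop)

lemma isCoupling_heatCoupling (d : ℕ) {t s r : ℝ} (hs : t ≤ s) (hr : t ≤ r) (m : Measure (Ed d))
    [SFinite m] :
    IsCoupling d (heatCoupling d m √(s - t) √(r - t)) (heatFlow d t s m) (heatFlow d t r m) := by
  constructor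
  · rw [heatFlow_eq_map d hs, heatCoupling, Measure.map_map (by fun_prop) (by fun_prop)]; rfl
  · rw [heatFlow_eq_map d hr, heatCoupling, Measure.map_map (by fun_prop) (by fun_prop)]; rfl

lemma integrable_norm_pow_stdGaussian (d k : ℕ) :
    Integrable (fun z => ‖z‖ ^ k) (ProbabilityTheory.stdGaussian (Ed d)) :=
  (ProbabilityTheory.IsGaussian.memLp_id (ProbabilityTheory.stdGaussian (Ed d)) k
    (by simp)).integrable_norm_pow'

lemma integral_heatCoupling (d : ℕ) (m : Measure (Ed d)) [IsProbabilityMeasure m] (a b p : ℝ) :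
    ∫ q, ‖q.1 - q.2‖ ^ p ∂(heatCoupling d m a b) =
      |a - b| ^ p * ∫ z, ‖z‖ ^ p ∂(ProbabilityTheory.stdGaussian (Ed d)) := by
  have hm : AEStronglyMeasurable (fun q : Ed d × Ed d => ‖q.1 - q.2‖ ^ p)
      (heatCoupling d m a b) := Measurable.aestronglyMeasurable (by fun_prop)
  rw [heatCoupling, integral_map (by fun_prop) hm, ← integral_const_mul]
  have h : ∀ q : Ed d × Ed d, ‖(q.1 + a • q.2) - (q.1 + b • q.2)‖ ^ p =
      |a - b| ^ p * ‖q.2‖ ^ p := by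
    intro q
    rw [add_sub_add_left_eq_sub, ← sub_smul, norm_smul, Real.norm_eq_abs,
      Real.mul_rpow (abs_nonneg _) (norm_nonneg _)]
  simp_rw [h]
  have := integral_fun_snd (μ := m) (ν := ProbabilityTheory.stdGaussian (Ed d))
    (fun z => |a - b| ^ p * ‖z‖ ^ p)
  simpa using this

lemma integrable_heatCoupling (d : ℕ) (m : Measure (Ed d)) [IsProbabilityMeasure m] (a b : ℝ) :
    Integrable (fun q => ‖q.1 - q.2‖ ^ (2 : ℝ)) (heatCoupling d m a b) := by
  have hm : AEStronglyMeasurable (fun q : Ed d × Ed d => ‖q.1 - q.2‖ ^ (2 : ℝ))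
      (heatCoupling d m a b) := Measurable.aestronglyMeasurable (by fun_prop)
  rw [heatCoupling, integrable_map_measure hm (by fun_prop)]
  have : Integrable (fun z => (a - b) ^ 2 * ‖z‖ ^ 2) (ProbabilityTheory.stdGaussian (Ed d)) :=
    (integrable_norm_pow_stdGaussian d 2).const_mul _
  refine (this.comp_snd m).congr (ae_of_all _ fun q => ?_)
  simp only [Function.comp, add_sub_add_left_eq_sub, ← sub_smul, norm_smul, Real.norm_eq_abs,
    Real.rpow_two, mul_pow, sq_abs]

lemma wdist_one_heatFlow_le (d : ℕ) {t s r : ℝ} (hs : t ≤ s) (hr : t ≤ r) (m : Measure (Ed d))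
    [IsProbabilityMeasure m] : wdist d 1 (heatFlow d t s m) (heatFlow d t r m) ≤
      |√(s - t) - √(r - t)| * ∫ z, ‖z‖ ∂(ProbabilityTheory.stdGaussian (Ed d)) := by
  refine (wdist_le (isCoupling_heatCoupling d hs hr m)).trans (le_of_eq ?_)
  rw [integral_heatCoupling]
  simp

lemma MemP.two_to_one {d : ℕ} {m : Measure (Ed d)} (h : MemP d 2 m) : MemP d 1 m := by
  have := h.1
  refine ⟨h.1, ((integrable_const (1 : ℝ)).add h.2).mono'
    (Measurable.aestronglyMeasurable (by fun_prop)) (ae_of_all _ fun x => ?_)⟩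
  simp only [Real.rpow_one, norm_norm, Pi.add_apply, Real.rpow_two]
  nlinarith [sq_nonneg (‖x‖ - 1)]

lemma MemP.heatFlow {d : ℕ} {m : Measure (Ed d)} (hm : MemP d 2 m) {t s : ℝ} (h : t ≤ s) :
    MemP d 2 (heatFlow d t s m) := by
  have := hm.1
  refine ⟨isProbabilityMeasure_heatFlow d h m, ?_⟩
  rw [heatFlow_eq_map d h, integrable_map_measure (Measurable.aestronglyMeasurable (by fun_prop))
    (by fun_prop)]
  have h1 : Integrable (fun q : Ed d × Ed d => 2 * ‖q.1‖ ^ (2 : ℝ))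
      (m.prod (ProbabilityTheory.stdGaussian (Ed d))) := (hm.2.comp_fst _).const_mul 2
  have h2 : Integrable (fun q : Ed d × Ed d => 2 * (s - t) * ‖q.2‖ ^ 2)
      (m.prod (ProbabilityTheory.stdGaussian (Ed d))) :=
    ((integrable_norm_pow_stdGaussian d 2).comp_snd m).const_mul _
  refine (h1.add h2).mono' (Measurable.aestronglyMeasurable (by fun_prop)) (ae_of_all _ fun q => ?_)
  simp only [Function.comp, Real.rpow_two, norm_pow, norm_norm, Pi.add_apply]
  have h3 := norm_add_le q.1 (√(s - t) • q.2)
  have h4 : ‖√(s - t) • q.2‖ ^ 2 = (s - t) * ‖q.2‖ ^ 2 := by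
    rw [norm_smul, mul_pow, Real.norm_of_nonneg (Real.sqrt_nonneg _),
      Real.sq_sqrt (by linarith)]
  have h5 : ‖q.1 + √(s - t) • q.2‖ ^ 2 ≤ (‖q.1‖ + ‖√(s - t) • q.2‖) ^ 2 := by gcongr
  nlinarith [sq_nonneg (‖q.1‖ - ‖√(s - t) • q.2‖)]

/-- The mixture `(1 - r) m + r m'`. -/
abbrev mix {d : ℕ} (m m' : Measure (Ed d)) (r : ℝ) : Measure (Ed d) :=
  (1 - ENNReal.ofReal r) • m + ENNReal.ofReal r • m'

lemma one_sub_ofReal {r : ℝ} (hr : 0 ≤ r) : 1 - ENNReal.ofReal r = ENNReal.ofReal (1 - r) := by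
  rw [ENNReal.ofReal_sub _ hr, ENNReal.ofReal_one]

lemma MemP.mix {d : ℕ} {m m' : Measure (Ed d)} (hm : MemP d 2 m) (hm' : MemP d 2 m') {r : ℝ}
    (hr : r ∈ Icc (0 : ℝ) 1) : MemP d 2 (mix m m' r) := by
  have := hm.1
  have := hm'.1
  refine ⟨⟨?_⟩, ?_⟩
  · simp only [Measure.add_apply, Measure.smul_apply, measure_univ, smul_eq_mul, mul_one]
    exact tsub_add_cancel_of_le (by simpa using hr.2)
  · exact (hm.2.smul_measure (by simp)).add_measure (hm'.2.smul_measure (by simp))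

lemma integral_mix {d : ℕ} {m m' : Measure (Ed d)} {r : ℝ} (hr : r ∈ Icc (0 : ℝ) 1)
    {g : Ed d → ℝ} (h : Integrable g m) (h' : Integrable g m') :
    ∫ x, g x ∂(mix m m' r) = (1 - r) * ∫ x, g x ∂m + r * ∫ x, g x ∂m' := by
  rw [integral_add_measure (h.smul_measure (by simp)) (h'.smul_measure (by simp)),
    integral_smul_measure, integral_smul_measure, one_sub_ofReal hr.1,
    ENNReal.toReal_ofReal (by linarith [hr.2]), ENNReal.toReal_ofReal hr.1]
  simp

lemma mix_mix {d : ℕ} (m m' : Measure (Ed d)) {r s : ℝ} (hr : r ∈ Icc (0 : ℝ) 1)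
    (hs : s ∈ Icc (0 : ℝ) 1) : mix (mix m m' r) m' s = mix m m' (r + s * (1 - r)) := by
  have h1 : 0 ≤ 1 - r := by linarith [hr.2]
  have h2 : 0 ≤ 1 - s := by linarith [hs.2]
  have h3 : 0 ≤ s * (1 - r) := mul_nonneg hs.1 h1
  simp only [mix, one_sub_ofReal hr.1, one_sub_ofReal hs.1, one_sub_ofReal (add_nonneg hr.1 h3),
    smul_add, smul_smul, ← ENNReal.ofReal_mul h2, add_assoc, ← add_smul]
  congr 2
  · congr 1; ring
  · rw [← ENNReal.ofReal_add (mul_nonneg h2 hr.1) hs.1]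
    congr 1; ring

lemma mix_one {d : ℕ} (m m' : Measure (Ed d)) : mix m m' 1 = m' := by simp [mix]

lemma mix_zero {d : ℕ} (m m' : Measure (Ed d)) : mix m m' 0 = m := by simp [mix]

lemma wdist_two_mix_le {d : ℕ} {m m' : Measure (Ed d)} [IsProbabilityMeasure m]
    [IsProbabilityMeasure m'] {γ : Measure (Ed d × Ed d)}
    [IsProbabilityMeasure γ] (hγ : IsCoupling d γ m m')
    (hi : Integrable (fun q => ‖q.1 - q.2‖ ^ (2 : ℝ)) γ) {r r' : ℝ} (hr : 0 ≤ r) (hrr : r ≤ r')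
    (hr' : r' ≤ 1) :
    wdist d 2 (mix m m' r) (mix m m' r') ≤
      ((r' - r) * ∫ q, ‖q.1 - q.2‖ ^ (2 : ℝ) ∂γ) ^ (1 / (2 : ℝ)) := by
  have e1 : ENNReal.ofReal (1 - r') + ENNReal.ofReal (r' - r) = ENNReal.ofReal (1 - r) := by
    rw [← ENNReal.ofReal_add (by linarith) (by linarith)]; congr 1; ring
  have e2 : ENNReal.ofReal r + ENNReal.ofReal (r' - r) = ENNReal.ofReal r' := by
    rw [← ENNReal.ofReal_add (by linarith) (by linarith)]; congr 1; ring
  let Γ : Measure (Ed d × Ed d) := ENNReal.ofReal (1 - r') • m.map (fun x => (x, x)) +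
    ENNReal.ofReal r • m'.map (fun x => (x, x)) + ENNReal.ofReal (r' - r) • γ
  have hd : Measurable fun x : Ed d => (x, x) := by fun_prop
  have hΓp : IsProbabilityMeasure Γ := by
    refine ⟨?_⟩
    simp only [Γ, Measure.add_apply, Measure.smul_apply, Measure.map_apply hd MeasurableSet.univ,
      preimage_univ, measure_univ, smul_eq_mul, mul_one]
    rw [add_assoc, e2, ← ENNReal.ofReal_add (by linarith) (by linarith)]
    simp
  have hΓ : IsCoupling d Γ (mix m m' r) (mix m m' r') := by
    constructor
    · simp only [Γ, Measure.map_add _ _ measurable_fst, Measure.map_smul, hγ.1,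
        Measure.map_map measurable_fst hd]
      simp only [Function.comp_def, Measure.map_id', mix, one_sub_ofReal hr, ← e1, add_smul]
      abel
    · simp only [Γ, Measure.map_add _ _ measurable_snd, Measure.map_smul, hγ.2,
        Measure.map_map measurable_snd hd]
      simp only [Function.comp_def, Measure.map_id', mix]
      rw [one_sub_ofReal (hr.trans hrr), ← e2, add_smul, add_assoc]
  refine (wdist_le hΓ).trans (le_of_eq ?_)
  have hdiag : ∀ μ : Measure (Ed d), Integrable (fun q : Ed d × Ed d => ‖q.1 - q.2‖ ^ (2 : ℝ))
      (μ.map fun x => (x, x)) := fun μ => by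
    rw [integrable_map_measure (Measurable.aestronglyMeasurable (by fun_prop)) (by fun_prop)]
    simp [Function.comp_def]
  have hdiag' : ∀ μ : Measure (Ed d), ∫ q : Ed d × Ed d, ‖q.1 - q.2‖ ^ (2 : ℝ)
      ∂(μ.map fun x => (x, x)) = 0 := fun μ => by
    rw [integral_map (by fun_prop) (Measurable.aestronglyMeasurable (by fun_prop))]
    simp
  rw [integral_add_measure (((hdiag m).smul_measure (by simp)).add_measure
      ((hdiag m').smul_measure (by simp))) (hi.smul_measure (by simp)),
    integral_add_measure ((hdiag m).smul_measure (by simp)) ((hdiag m').smul_measure (by simp)),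
    integral_smul_measure, integral_smul_measure, integral_smul_measure, hdiag', hdiag',
    ENNReal.toReal_ofReal (sub_nonneg.2 hrr)]
  simp

/-- The standing assumptions on the running cost `f`. -/
structure IsRegularCost {d : ℕ} {A B : Type} [TopologicalSpace A] [TopologicalSpace B]
    (f : ℝ → Ed d → A → B → ℝ) (C : ℝ) : Prop where
  bdd : ∀ s x u v, |f s x u v| ≤ C
  cont : Continuous fun q : ℝ × Ed d × A × B => f q.1 q.2.1 q.2.2.1 q.2.2.2
  lip : ∀ (u : A) (v : B), ∀ s s' : ℝ, ∀ x x' : Ed d,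
    |f s x u v - f s' x' u v| ≤ C * (‖x - x'‖ + |s - s'|)

lemma ciInf_ciSup_le_add {A B : Type} [Nonempty A] [Nonempty B] {a b : A → B → ℝ} {C ε : ℝ}
    (ha : ∀ u v, |a u v| ≤ C) (hb : ∀ u v, |b u v| ≤ C) (h : ∀ u v, a u v ≤ b u v + ε) :
    ⨅ u, ⨆ v, a u v ≤ (⨅ u, ⨆ v, b u v) + ε := by
  have hab : ∀ u, BddAbove (range (a u)) := fun u => ⟨C, by
    rintro _ ⟨v, rfl⟩; exact (abs_le.1 (ha u v)).2⟩
  have hbb : ∀ u, BddAbove (range (b u)) := fun u => ⟨C, by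
    rintro _ ⟨v, rfl⟩; exact (abs_le.1 (hb u v)).2⟩
  have hai : BddBelow (range fun u => ⨆ v, a u v) := ⟨-C, by
    rintro _ ⟨u, rfl⟩
    exact (abs_le.1 (ha u (Classical.arbitrary B))).1.trans (le_ciSup (hab u) _)⟩
  rw [← sub_le_iff_le_add]
  refine le_ciInf fun u => ?_
  rw [sub_le_iff_le_add]
  exact (ciInf_le hai u).trans (ciSup_le fun v => (h u v).trans
    (add_le_add_left (le_ciSup (hbb u) v) _))

lemma abs_ciInf_ciSup_sub_le {A B : Type} [Nonempty A] [Nonempty B] {a b : A → B → ℝ} {C ε : ℝ}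
    (ha : ∀ u v, |a u v| ≤ C) (hb : ∀ u v, |b u v| ≤ C) (h : ∀ u v, |a u v - b u v| ≤ ε) :
    |(⨅ u, ⨆ v, a u v) - ⨅ u, ⨆ v, b u v| ≤ ε := by
  rw [abs_sub_le_iff, sub_le_iff_le_add', sub_le_iff_le_add']
  exact ⟨ciInf_ciSup_le_add ha hb fun u v => by linarith [(abs_sub_le_iff.1 (h u v)).1],
    ciInf_ciSup_le_add hb ha fun u v => by linarith [(abs_sub_le_iff.1 (h u v)).2]⟩

lemma ciSup_denseSeq {B : Type} [TopologicalSpace B] [TopologicalSpace.SeparableSpace B]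
    [Nonempty B] {g : B → ℝ} (hg : Continuous g) (hb : BddAbove (range g)) :
    ⨆ v, g v = ⨆ n, g (TopologicalSpace.denseSeq B n) := by
  have hb' : BddAbove (range fun n => g (TopologicalSpace.denseSeq B n)) :=
    hb.mono (by rintro _ ⟨n, rfl⟩; exact ⟨_, rfl⟩)
  refine le_antisymm (ciSup_le fun v => ?_) (ciSup_le fun n => le_ciSup hb _)
  exact (TopologicalSpace.denseRange_denseSeq B).induction_on
    (p := fun v => g v ≤ ⨆ n, g (TopologicalSpace.denseSeq B n)) v
    (isClosed_le hg continuous_const) fun n => le_ciSup hb' n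

lemma ciInf_denseSeq {B : Type} [TopologicalSpace B] [TopologicalSpace.SeparableSpace B]
    [Nonempty B] {g : B → ℝ} (hg : Continuous g) (hb : BddBelow (range g)) :
    ⨅ v, g v = ⨅ n, g (TopologicalSpace.denseSeq B n) := by
  have hb' : BddBelow (range fun n => g (TopologicalSpace.denseSeq B n)) :=
    hb.mono (by rintro _ ⟨n, rfl⟩; exact ⟨_, rfl⟩)
  refine le_antisymm (le_ciInf fun n => ciInf_le hb _) (le_ciInf fun v => ?_)
  exact (TopologicalSpace.denseRange_denseSeq B).induction_on
    (p := fun v => ⨅ n, g (TopologicalSpace.denseSeq B n) ≤ g v) v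
    (isClosed_le continuous_const hg) fun n => ciInf_le hb' n

namespace IsRegularCost

section

variable {d : ℕ} {A B : Type} [MetricSpace A] [MetricSpace B] {f : ℝ → Ed d → A → B → ℝ} {C : ℝ}

lemma nonneg [Nonempty A] [Nonempty B] (hf : IsRegularCost f C) : 0 ≤ C :=
  (abs_nonneg _).trans
    (hf.bdd 0 0 (Classical.arbitrary A) (Classical.arbitrary B))

lemma continuous_space (hf : IsRegularCost f C) (s : ℝ) (u : A) (v : B) :
    Continuous fun x => f s x u v :=
  hf.cont.comp (f := fun x => (s, x, u, v)) (by fun_prop)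

lemma integrable (hf : IsRegularCost f C) (s : ℝ) (u : A) (v : B) (μ : Measure (Ed d))
    [IsFiniteMeasure μ] : Integrable (fun x => f s x u v) μ :=
  .of_bound (hf.continuous_space s u v).aestronglyMeasurable C
    (ae_of_all _ fun x => hf.bdd s x u v)

lemma abs_integral_le (hf : IsRegularCost f C) (s : ℝ) (u : A) (v : B) (μ : Measure (Ed d))
    [IsProbabilityMeasure μ] : |∫ x, f s x u v ∂μ| ≤ C := by
  have h := norm_integral_le_of_norm_le_const (μ := μ) (f := fun x => f s x u v) (C := C)
    (ae_of_all _ fun x => hf.bdd s x u v)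
  simpa using h

lemma continuous_integral (hf : IsRegularCost f C) (s : ℝ) (μ : Measure (Ed d))
    [IsFiniteMeasure μ] : Continuous fun q : A × B => ∫ x, f s x q.1 q.2 ∂μ :=
  continuous_of_dominated (bound := fun _ => C)
    (fun q => (hf.continuous_space s q.1 q.2).aestronglyMeasurable)
    (fun q => ae_of_all _ fun x => hf.bdd s x _ _) (integrable_const _)
    (ae_of_all _ fun x => hf.cont.comp (f := fun q : A × B => (s, x, q.1, q.2)) (by fun_prop))

variable [Nonempty A] [Nonempty B]

lemma abs_hamiltonian_le (hf : IsRegularCost f C) (s : ℝ) (μ : Measure (Ed d))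
    [IsProbabilityMeasure μ] : |hamiltonian f s μ| ≤ C := by
  have h := abs_ciInf_ciSup_sub_le (a := fun u v => ∫ x, f s x u v ∂μ) (b := fun _ _ => 0)
    (fun u v => hf.abs_integral_le s u v μ) (fun _ _ => by simpa using hf.nonneg)
    (fun u v => by simpa using hf.abs_integral_le s u v μ)
  simpa [hamiltonian] using h

lemma abs_hamiltonian_sub_le (hf : IsRegularCost f C) (s s' : ℝ) {μ μ' : Measure (Ed d)}
    (hμ : MemP d 1 μ) (hμ' : MemP d 1 μ') :
    |hamiltonian f s μ - hamiltonian f s' μ'| ≤ C * (wdist d 1 μ μ' + |s - s'|) := by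
  have := hμ.1
  have := hμ'.1
  have key : ∀ γ : Measure (Ed d × Ed d), IsProbabilityMeasure γ → IsCoupling d γ μ μ' →
      |hamiltonian f s μ - hamiltonian f s' μ'| ≤
        C * ((∫ q, ‖q.1 - q.2‖ ^ (1 : ℝ) ∂γ) ^ (1 / (1 : ℝ)) + |s - s'|) := by
    intro γ hγ ⟨h1, h2⟩
    refine abs_ciInf_ciSup_sub_le (fun u v => hf.abs_integral_le s u v μ)
      (fun u v => hf.abs_integral_le s' u v μ') fun u v => ?_
    have i1 : Integrable (fun q : Ed d × Ed d => f s q.1 u v) γ :=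
      .of_bound ((hf.continuous_space s u v).comp continuous_fst).aestronglyMeasurable C
        (ae_of_all _ fun x => hf.bdd _ _ _ _)
    have i2 : Integrable (fun q : Ed d × Ed d => f s' q.2 u v) γ :=
      .of_bound ((hf.continuous_space s' u v).comp continuous_snd).aestronglyMeasurable C
        (ae_of_all _ fun x => hf.bdd _ _ _ _)
    have i3 : Integrable (fun q : Ed d × Ed d => ‖q.1‖) γ := by
      have := hμ.2
      rw [← h1, integrable_map_measure (Measurable.aestronglyMeasurable (by fun_prop))
        (by fun_prop)] at this
      simpa [Function.comp_def] using this
    have i4 : Integrable (fun q : Ed d × Ed d => ‖q.2‖) γ := by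
      have := hμ'.2
      rw [← h2, integrable_map_measure (Measurable.aestronglyMeasurable (by fun_prop))
        (by fun_prop)] at this
      simpa [Function.comp_def] using this
    have i5 : Integrable (fun q : Ed d × Ed d => ‖q.1 - q.2‖) γ :=
      (i3.add i4).mono' (Measurable.aestronglyMeasurable (by fun_prop))
        (ae_of_all _ fun q => by simpa using norm_sub_le q.1 q.2)
    have e1 : ∫ x, f s x u v ∂μ = ∫ q, f s q.1 u v ∂γ := by
      rw [← h1, integral_map (by fun_prop) (hf.continuous_space s u v).aestronglyMeasurable]
    have e2 : ∫ x, f s' x u v ∂μ' = ∫ q, f s' q.2 u v ∂γ := by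
      rw [← h2, integral_map (by fun_prop) (hf.continuous_space s' u v).aestronglyMeasurable]
    rw [e1, e2, ← integral_sub i1 i2]
    refine (abs_integral_le_integral_abs).trans ((integral_mono (i1.sub i2).abs
      ((i5.add (integrable_const |s - s'|)).const_mul C)
      fun q => hf.lip u v s s' q.1 q.2).trans (le_of_eq ?_))
    rw [integral_const_mul, integral_add' i5 (integrable_const _)]
    simp
  rcases hf.nonneg.eq_or_lt with h0 | h0
  · have := key (μ.prod μ') inferInstance ⟨by simp, by simp⟩
    simpa [← h0] using this
  · rw [← div_le_iff₀' h0, ← sub_le_iff_le_add]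
    refine le_csInf ⟨_, μ.prod μ', inferInstance, ⟨by simp, by simp⟩, rfl⟩ ?_
    rintro _ ⟨γ, hγ, hc, rfl⟩
    rw [sub_le_iff_le_add, div_le_iff₀' h0]
    exact key γ hγ hc

end

variable {d : ℕ} {A B : Type} [MetricSpace A] [CompactSpace A] [Nonempty A]
  [MetricSpace B] [CompactSpace B] [Nonempty B] {f : ℝ → Ed d → A → B → ℝ} {C : ℝ}

lemma measurable_hamiltonian (hf : IsRegularCost f C) {Ω : Type} [MeasurableSpace Ω]
    {M : Ω → Measure (Ed d)} (hM : Measurable M) (hp : ∀ ω, IsProbabilityMeasure (M ω)) (s : ℝ) :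
    Measurable fun ω => hamiltonian f s (M ω) := by
  have hba : ∀ ω u, BddAbove (range fun v => ∫ x, f s x u v ∂(M ω)) := fun ω u =>
    ⟨C, by rintro _ ⟨v, rfl⟩; exact (abs_le.1 (hf.abs_integral_le s u v _)).2⟩
  have hbb : ∀ ω, BddBelow (range fun u => ⨆ v, ∫ x, f s x u v ∂(M ω)) := fun ω =>
    ⟨-C, by
      rintro _ ⟨u, rfl⟩
      exact (abs_le.1 (hf.abs_integral_le s u (Classical.arbitrary B) _)).1.trans
        (le_ciSup (hba ω u) _)⟩
  have hcs : ∀ ω, Continuous fun u => ⨆ v, ∫ x, f s x u v ∂(M ω) := fun ω => by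
    have := (isCompact_univ (X := B)).continuous_sSup
      (f := fun (u : A) (v : B) => ∫ x, f s x u v ∂(M ω)) (hf.continuous_integral s (M ω))
    simpa only [image_univ, sSup_range] using this
  have e : ∀ ω, hamiltonian f s (M ω) = ⨅ n, ⨆ k,
      ∫ x, f s x (TopologicalSpace.denseSeq A n) (TopologicalSpace.denseSeq B k) ∂(M ω) := by
    intro ω
    rw [hamiltonian, ciInf_denseSeq (hcs ω) (hbb ω)]
    refine iInf_congr fun n => ?_
    exact ciSup_denseSeq ((hf.continuous_integral s (M ω)).comp
      (f := fun v => (TopologicalSpace.denseSeq A n, v)) (by fun_prop)) (hba ω _)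
  simp_rw [e]
  refine .iInf fun n => .iSup fun k => ?_
  let κ : ProbabilityTheory.Kernel Ω (Ed d) := ⟨M, hM⟩
  have : ProbabilityTheory.IsMarkovKernel κ := ⟨hp⟩
  exact ((hf.continuous_space s _ _).stronglyMeasurable.integral_kernel (κ := κ)).measurable

end IsRegularCost

lemma measurable_uncurry_of_rightContinuous {Ω : Type} [MeasurableSpace Ω] {G : ℝ → Ω → ℝ}
    (hm : ∀ s, Measurable (G s))
    (hc : ∀ s ω, Tendsto (fun r => G r ω) (𝓝[≥] s) (𝓝 (G s ω))) :
    Measurable fun p : ℝ × Ω => G p.1 p.2 := by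
  let a : ℕ → ℝ → ℝ := fun n s => (⌊(n + 1) * s⌋ + 1 : ℝ) / (n + 1)
  refine measurable_of_tendsto_metrizable (f := fun n (p : ℝ × Ω) => G (a n p.1) p.2)
    (fun n => ?_) (tendsto_pi_nhds.2 fun p => ?_)
  · have h1 : Measurable fun q : ℤ × Ω => G ((q.1 + 1 : ℝ) / (n + 1)) q.2 :=
      measurable_from_prod_countable_right fun k => hm ((k + 1 : ℝ) / (n + 1))
    exact h1.comp (f := fun p : ℝ × Ω => (⌊(n + 1) * p.1⌋, p.2)) (by fun_prop)
  · have hlow : ∀ n, p.1 ≤ a n p.1 := fun n => by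
      rw [le_div_iff₀ (by positivity), mul_comm]
      exact (Int.lt_floor_add_one _).le
    have hup : ∀ n, a n p.1 ≤ p.1 + 1 / (n + 1) := fun n => by
      rw [div_le_iff₀ (by positivity), add_mul p.1, one_div, inv_mul_cancel₀ (by positivity),
        mul_comm p.1]
      linarith [Int.floor_le ((n + 1) * p.1)]
    refine (hc p.1 p.2).comp (tendsto_nhdsWithin_iff.2 ⟨?_, Eventually.of_forall hlow⟩)
    refine tendsto_of_tendsto_of_tendsto_of_le_of_le tendsto_const_nhds ?_ hlow hup
    simpa using tendsto_const_nhds.add (tendsto_one_div_add_atTop_nhds_zero_nat (𝕜 := ℝ))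

lemma genFiltration_le {Ω : Type} {mΩ : MeasurableSpace Ω} {d : ℕ} {M : ℝ → Ω → Measure (Ed d)}
    (hM : ∀ s, Measurable (M s)) (t s : ℝ) : genFiltration d M t s ≤ mΩ :=
  (iInf₂_le (s + 1) (by simp)).trans (iSup₂_le fun r _ => (hM r).comap_le)

/-- The process following the heat flow before time `t'` and `M` from then on. -/
def heatThen {Ω : Type} {d : ℕ} (t t' : ℝ) (m : Measure (Ed d)) (M : ℝ → Ω → Measure (Ed d)) :
    ℝ → Ω → Measure (Ed d) :=
  fun s ω => if s < t' then heatFlow d t s m else M s ω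

lemma heatThen_of_lt {Ω : Type} {d : ℕ} {t t' s : ℝ} (h : s < t') (m : Measure (Ed d))
    (M : ℝ → Ω → Measure (Ed d)) : heatThen t t' m M s = fun _ => heatFlow d t s m := by
  funext ω; simp [heatThen, h]

lemma heatThen_of_le {Ω : Type} {d : ℕ} {t t' s : ℝ} (h : t' ≤ s) (m : Measure (Ed d))
    (M : ℝ → Ω → Measure (Ed d)) : heatThen t t' m M s = M s := by
  funext ω; simp [heatThen, h.not_gt]

lemma genFiltration_heatThen_of_lt {Ω : Type} {d : ℕ} {t t' s : ℝ} (h : s < t')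
    (m : Measure (Ed d)) (M : ℝ → Ω → Measure (Ed d)) :
    genFiltration d (heatThen t t' m M) t s = ⊥ := by
  obtain ⟨u, hu, hu'⟩ := exists_between h
  refine le_bot_iff.1 ((iInf₂_le u hu).trans (iSup₂_le fun r hr => ?_))
  rw [heatThen_of_lt (hr.2.trans_lt hu'), MeasurableSpace.comap_const]

lemma genFiltration_heatThen {Ω : Type} {d : ℕ} {t t' : ℝ} (htt' : t ≤ t') (s : ℝ)
    (m : Measure (Ed d)) (M : ℝ → Ω → Measure (Ed d)) :
    genFiltration d (heatThen t t' m M) t s = genFiltration d M t' s := by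
  refine iInf_congr fun u => iInf_congr fun hu => le_antisymm
    (iSup₂_le fun r hr => ?_) (iSup₂_le fun r hr => ?_)
  · rcases lt_or_ge r t' with hrt | hrt
    · rw [heatThen_of_lt hrt, MeasurableSpace.comap_const]
      exact bot_le
    · rw [heatThen_of_le hrt]
      exact le_iSup₂_of_le r ⟨hrt, hr.2⟩ le_rfl
  · rw [← heatThen_of_le (t := t) hr.1 m M]
    exact le_iSup₂_of_le r ⟨htt'.trans hr.1, hr.2⟩ le_rfl

lemma tendsto_wdist_heatFlow (d : ℕ) {t s : ℝ} (h : t ≤ s) {m : Measure (Ed d)}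
    [IsProbabilityMeasure m] :
    Tendsto (fun r => wdist d 1 (heatFlow d t r m) (heatFlow d t s m)) (𝓝[Ici t] s) (𝓝 0) := by
  have h0 : Tendsto (fun r => |√(r - t) - √(s - t)| *
      ∫ z, ‖z‖ ∂(ProbabilityTheory.stdGaussian (Ed d))) (𝓝 s) (𝓝 0) := by
    have : Continuous fun r => |√(r - t) - √(s - t)| *
      ∫ z, ‖z‖ ∂(ProbabilityTheory.stdGaussian (Ed d)) := by fun_prop
    simpa using this.tendsto s
  refine tendsto_of_tendsto_of_tendsto_of_le_of_le' tendsto_const_nhds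
    (h0.mono_left nhdsWithin_le_nhds) (Eventually.of_forall fun r => wdist_nonneg _ _ _ _) ?_
  filter_upwards [self_mem_nhdsWithin] with r hr
  exact wdist_one_heatFlow_le d hr h m

lemma cadlagD1_heatThen {Ω : Type} {d : ℕ} {t t' T : ℝ} {m : Measure (Ed d)}
    [IsProbabilityMeasure m] {M : ℝ → Ω → Measure (Ed d)} {ω : Ω}
    (hM : CadlagD1 d t' T fun s => M s ω) :
    CadlagD1 d t T fun s => heatThen t t' m M s ω := by
  constructor
  · intro s hs
    rcases lt_or_ge s t' with h | h
    · have := (tendsto_wdist_heatFlow d hs.1 (m := m)).mono_left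
        (nhdsWithin_mono _ (Ici_subset_Ici.2 hs.1))
      refine this.congr' ?_
      filter_upwards [mem_nhdsWithin_of_mem_nhds (Iio_mem_nhds h)] with r hr
      simp only [heatThen_of_lt h, heatThen_of_lt (mem_Iio.1 hr)]
    · refine (hM.1 s ⟨h, hs.2⟩).congr' ?_
      filter_upwards [self_mem_nhdsWithin] with r hr
      simp only [heatThen_of_le h, heatThen_of_le (h.trans hr)]
  · intro s hs
    rcases le_or_gt s t' with h | h
    · refine ⟨heatFlow d t s m, ?_⟩
      have := (tendsto_wdist_heatFlow d hs.1.le (m := m)).mono_left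
        (nhdsWithin_mono s (s := Ico t s) Ico_subset_Ici_self)
      refine this.congr' ?_
      filter_upwards [self_mem_nhdsWithin] with r hr
      simp only [heatThen_of_lt (hr.2.trans_le h)]
    · obtain ⟨μ, hμ⟩ := hM.2 s ⟨h, hs.2⟩
      refine ⟨μ, ?_⟩
      have e : 𝓝[Ico t s] s = 𝓝[Ico t' s] s := by
        rw [nhdsWithin_Ico_eq_nhdsLT hs.1, nhdsWithin_Ico_eq_nhdsLT h]
      rw [e]
      refine hμ.congr' ?_
      filter_upwards [self_mem_nhdsWithin] with r hr
      simp only [heatThen_of_le hr.1]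

/-- The element of `𝓜(t,m)` following the heat flow before time `t'` and `X` from then on. -/
def MVP.heatConcat {d : ℕ} {T t t' : ℝ} {m : Measure (Ed d)} (hm : MemP d 2 m) (htt' : t ≤ t')
    (X : MVP d T t' (heatFlow d t t' m)) : MVP d T t m where
  Ω := X.Ω
  mΩ := X.mΩ
  P := X.P
  probP := X.probP
  M := heatThen t t' m X.M
  meas s := by
    rcases lt_or_ge s t' with h | h
    · rw [heatThen_of_lt h]; exact @measurable_const _ _ _ X.mΩ _
    · rw [heatThen_of_le h]; exact X.meas s
  inP1 s hs ω := by
    rcases lt_or_ge s t' with h | h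
    · rw [heatThen_of_lt h]; exact (hm.heatFlow hs.1).two_to_one
    · rw [heatThen_of_le h]; exact X.inP1 s ⟨h, hs.2⟩ ω
  cadlag ω := by
    have := hm.1
    exact cadlagD1_heatThen (X.cadlag ω)
  init φ := by
    have := X.probP
    rcases htt'.lt_or_eq with h | h
    · rw [heatThen_of_lt h, heatFlow_self]; simp
    · rw [heatThen_of_le h.ge]
      subst h
      exact (X.init φ).trans (by rw [heatFlow_self])
  cond t₁ t₂ h1 h12 h2 φ := by
    let _ := X.mΩ
    have := X.probP
    have := hm.1
    rcases lt_or_ge t₁ t' with h | h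
    · rw [genFiltration_heatThen_of_lt h, condExp_bot, heatThen_of_lt h]
      refine .of_eq (funext fun _ => ?_)
      rw [heatFlow_heatFlow d h1 h12]
      rcases lt_or_ge t₂ t' with h' | h'
      · rw [heatThen_of_lt h']; simp
      · have hp := isProbabilityMeasure_heatFlow d htt' m
        obtain ⟨φ', hφ'⟩ := exists_integral_heatFlow_eq d h' φ
        rw [heatThen_of_le h', ← heatFlow_heatFlow d htt' h', hφ' _ hp, ← X.init φ',
          ← integral_condExp (genFiltration_le X.meas t' t'),
          integral_congr_ae (X.cond t' t₂ le_rfl h' h2 φ)]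
        exact integral_congr_ae (ae_of_all _ fun ω =>
          hφ' _ (X.inP1 t' ⟨le_rfl, h'.trans h2⟩ ω).1)
    · rw [genFiltration_heatThen htt', heatThen_of_le h, heatThen_of_le (h.trans h12)]
      exact X.cond t₁ t₂ h h12 h2 φ

/-- The unique element of `𝓜(T,m)` that is deterministic. -/
def MVP.terminal {d : ℕ} (T : ℝ) {m : Measure (Ed d)} (hm : MemP d 2 m) : MVP d T T m where
  Ω := Unit
  mΩ := ⊤
  P := @Measure.dirac Unit ⊤ ()
  probP := @Measure.dirac.isProbabilityMeasure _ ⊤ ()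
  M _ _ := m
  meas _ := @measurable_const _ _ _ ⊤ _
  inP1 _ _ _ := hm.two_to_one
  cadlag _ := ⟨by simp, by simp⟩
  init φ := by simp
  cond t₁ t₂ h1 h12 h2 φ := by
    obtain rfl : t₁ = t₂ := by linarith
    rw [heatFlow_self]
    rw [condExp_const (genFiltration_le (fun _ => measurable_const) _ _)]

lemma MVP.nonempty {d : ℕ} {T t : ℝ} (h : t ≤ T) {m : Measure (Ed d)} (hm : MemP d 2 m) :
    Nonempty (MVP d T t m) :=
  ⟨.heatConcat hm h (.terminal T (hm.heatFlow h))⟩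

namespace IsRegularCost

variable {d : ℕ} {A B : Type} [MetricSpace A] [CompactSpace A] [Nonempty A]
  [MetricSpace B] [CompactSpace B] [Nonempty B] {f : ℝ → Ed d → A → B → ℝ} {C T t : ℝ}
  {m : Measure (Ed d)}

lemma tendsto_hamiltonian_path (hf : IsRegularCost f C) (X : MVP d T t m) (ω : X.Ω) {s : ℝ}
    (hs : s ∈ Ico t T) :
    Tendsto (fun r => hamiltonian f r (X.M r ω)) (𝓝[≥] s) (𝓝 (hamiltonian f s (X.M s ω))) := by
  rw [tendsto_iff_dist_tendsto_zero]
  have h1 : Tendsto (fun r => C * (wdist d 1 (X.M r ω) (X.M s ω) + |r - s|)) (𝓝[≥] s) (𝓝 0) := by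
    have h2 : Tendsto (fun r => |r - s|) (𝓝[≥] s) (𝓝 0) := by
      have : Continuous fun r => |r - s| := by fun_prop
      simpa using (this.tendsto s).mono_left nhdsWithin_le_nhds
    simpa using (((X.cadlag ω).1 s hs).add h2).const_mul C
  refine tendsto_of_tendsto_of_tendsto_of_le_of_le' tendsto_const_nhds h1
    (Eventually.of_forall fun _ => dist_nonneg) ?_
  filter_upwards [self_mem_nhdsWithin, mem_nhdsWithin_of_mem_nhds (Iio_mem_nhds hs.2)] with r hr hr'
  exact hf.abs_hamiltonian_sub_le r s (X.inP1 r ⟨hs.1.trans hr, (mem_Iio.1 hr').le⟩ ω)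
    (X.inP1 s ⟨hs.1, hs.2.le⟩ ω)

lemma measurable_hamiltonian_process (hf : IsRegularCost f C) (htT : t ≤ T) (X : MVP d T t m) :
    let _ := X.mΩ
    Measurable fun p : ℝ × X.Ω =>
      hamiltonian f (max t (min p.1 T)) (X.M (max t (min p.1 T)) p.2) := by
  intro _
  have hmem : ∀ s, max t (min s T) ∈ Icc t T := fun s =>
    ⟨le_max_left _ _, max_le htT (min_le_right _ _)⟩
  refine measurable_uncurry_of_rightContinuous
    (G := fun s ω => hamiltonian f (max t (min s T)) (X.M (max t (min s T)) ω))
    (fun s => hf.measurable_hamiltonian (X.meas _) (fun ω => (X.inP1 _ (hmem s) ω).1) _)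
    fun s ω => ?_
  rcases lt_or_ge s t with h | h
  · refine tendsto_nhds_of_eventually_eq ?_
    filter_upwards [mem_nhdsWithin_of_mem_nhds (Iio_mem_nhds h)] with r hr
    rw [max_eq_left (min_le_of_left_le (mem_Iio.1 hr).le), max_eq_left (min_le_of_left_le h.le)]
  · rcases lt_or_ge s T with h' | h'
    · rw [min_eq_left h'.le, max_eq_right h]
      refine (hf.tendsto_hamiltonian_path X ω ⟨h, h'⟩).congr' ?_
      filter_upwards [self_mem_nhdsWithin,
        mem_nhdsWithin_of_mem_nhds (Iio_mem_nhds h')] with r hr hr'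
      rw [min_eq_left (mem_Iio.1 hr').le, max_eq_right (h.trans hr)]
    · refine tendsto_nhds_of_eventually_eq ?_
      filter_upwards [self_mem_nhdsWithin] with r hr
      rw [min_eq_right h', min_eq_right (h'.trans hr)]

lemma clamp_eq {s : ℝ} (hs : s ∈ Icc t T) : max t (min s T) = s := by
  rw [min_eq_left hs.2, max_eq_right hs.1]

lemma integrableOn_path (hf : IsRegularCost f C) (htT : t ≤ T) (X : MVP d T t m) (ω : X.Ω) :
    IntegrableOn (fun s => hamiltonian f s (X.M s ω)) (Icc t T) := by
  let _ := X.mΩ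
  have hm : Measurable fun s =>
      hamiltonian f (max t (min s T)) (X.M (max t (min s T)) ω) :=
    (hf.measurable_hamiltonian_process htT X).comp (f := fun s => (s, ω)) (by fun_prop)
  refine (Measure.integrableOn_of_bounded (M := C) (by simp) hm.aestronglyMeasurable ?_).congr_fun
    (fun s hs => ?_) measurableSet_Icc
  · refine ae_of_all _ fun s => ?_
    have := (X.inP1 (max t (min s T)) ⟨le_max_left _ _, max_le htT (min_le_right _ _)⟩ ω).1
    exact hf.abs_hamiltonian_le _ _
  · simp only [clamp_eq hs]

lemma abs_path_cost_le (hf : IsRegularCost f C) (htT : t ≤ T) (X : MVP d T t m) (ω : X.Ω) :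
    |∫ s in Icc t T, hamiltonian f s (X.M s ω)| ≤ C * (T - t) := by
  have h := norm_setIntegral_le_of_norm_le_const (μ := volume) (s := Icc t T) (C := C)
    (f := fun s => hamiltonian f s (X.M s ω)) (by simp) fun s hs => by
      have := (X.inP1 s hs ω).1
      exact hf.abs_hamiltonian_le _ _
  simpa [Measure.real, ENNReal.toReal_ofReal (sub_nonneg.2 htT)] using h

lemma integrable_path_cost (hf : IsRegularCost f C) (htT : t ≤ T) (X : MVP d T t m) :
    Integrable (fun ω => ∫ s in Icc t T, hamiltonian f s (X.M s ω)) X.P := by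
  let _ := X.mΩ
  have := X.probP
  refine .of_bound ?_ (C * (T - t)) (ae_of_all _ fun ω => hf.abs_path_cost_le htT X ω)
  have h := (hf.measurable_hamiltonian_process htT X).stronglyMeasurable.integral_prod_left'
    (μ := volume.restrict (Icc t T))
  refine h.aestronglyMeasurable.congr (ae_of_all _ fun ω => ?_)
  exact setIntegral_congr_fun measurableSet_Icc fun s hs => by simp only [clamp_eq hs]

lemma abs_mvCost_le (hf : IsRegularCost f C) (htT : t ≤ T) (X : MVP d T t m) :
    |mvCost f X| ≤ C * (T - t) := by
  let _ := X.mΩ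
  have := X.probP
  have h := norm_integral_le_of_norm_le_const (μ := X.P) (C := C * (T - t))
    (f := fun ω => ∫ s in Icc t T, hamiltonian f s (X.M s ω))
    (ae_of_all _ fun ω => hf.abs_path_cost_le htT X ω)
  simpa [mvCost] using h

lemma bddBelow_mvCost (hf : IsRegularCost f C) (htT : t ≤ T) (m : Measure (Ed d)) :
    BddBelow { r : ℝ | ∃ X : MVP d T t m, r = mvCost f X } :=
  ⟨-(C * (T - t)), by rintro _ ⟨X, rfl⟩; exact (abs_le.1 (hf.abs_mvCost_le htT X)).1⟩

lemma mvCost_heatConcat_le (hf : IsRegularCost f C) {t' : ℝ} (htt' : t ≤ t') (ht'T : t' ≤ T)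
    (hm : MemP d 2 m) (X : MVP d T t' (heatFlow d t t' m)) :
    mvCost f (X.heatConcat hm htt') ≤ (t' - t) * (hamiltonian f t m +
      C * (√(t' - t) * (∫ z, ‖z‖ ∂(ProbabilityTheory.stdGaussian (Ed d))) + (t' - t))) +
      mvCost f X := by
  let _ := X.mΩ
  have := X.probP
  have := hm.1
  set K := hamiltonian f t m +
      C * (√(t' - t) * (∫ z, ‖z‖ ∂(ProbabilityTheory.stdGaussian (Ed d))) + (t' - t)) with hK
  have key : ∀ ω : X.Ω, ∫ s in Icc t T, hamiltonian f s ((X.heatConcat hm htt').M s ω) ≤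
      (t' - t) * K + ∫ s in Icc t' T, hamiltonian f s (X.M s ω) := by
    intro ω
    have hi := hf.integrableOn_path (htt'.trans ht'T) (X.heatConcat hm htt') ω
    have hsub : Ico t t' ⊆ Icc t T := fun s hs => ⟨hs.1, hs.2.le.trans ht'T⟩
    have hdisj : Disjoint (Ico t t') (Icc t' T) :=
      disjoint_left.2 fun s hs hs' => hs.2.not_ge hs'.1
    rw [← Ico_union_Icc_eq_Icc htt' ht'T, setIntegral_union hdisj measurableSet_Icc
      (hi.mono_set hsub) (hi.mono_set (Icc_subset_Icc_left htt'))]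
    refine add_le_add ?_ (le_of_eq ?_)
    · have hle : ∀ s ∈ Ico t t', hamiltonian f s ((X.heatConcat hm htt').M s ω) ≤ K := by
        intro s hs
        have e : (X.heatConcat hm htt').M s ω = heatFlow d t s m :=
          congrFun (heatThen_of_lt hs.2 m X.M) ω
        rw [e]
        have h1 := (abs_sub_le_iff.1 (hf.abs_hamiltonian_sub_le s t
          (hm.heatFlow hs.1).two_to_one hm.two_to_one)).1
        have h2 := wdist_one_heatFlow_le d hs.1 le_rfl m
        rw [heatFlow_self, sub_self, Real.sqrt_zero, sub_zero,
          abs_of_nonneg (Real.sqrt_nonneg _)] at h2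
        rw [abs_of_nonneg (sub_nonneg.2 hs.1)] at h1
        have h3 : √(s - t) ≤ √(t' - t) := Real.sqrt_le_sqrt (by linarith [hs.2])
        have h4 : 0 ≤ ∫ z, ‖z‖ ∂(ProbabilityTheory.stdGaussian (Ed d)) :=
          integral_nonneg fun _ => norm_nonneg _
        have h5 : C * (wdist d 1 (heatFlow d t s m) m + (s - t)) ≤
            C * (√(t' - t) * (∫ z, ‖z‖ ∂(ProbabilityTheory.stdGaussian (Ed d))) + (t' - t)) := by
          refine mul_le_mul_of_nonneg_left (add_le_add (h2.trans ?_) ?_) hf.nonneg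
          · gcongr
          · linarith [hs.2]
        linarith
      have h6 := setIntegral_mono_on (hi.mono_set hsub)
        (integrableOn_const (μ := volume) (s := Ico t t') (C := K) (by simp)) measurableSet_Ico hle
      simpa [Measure.real, ENNReal.toReal_ofReal (sub_nonneg.2 htt')] using h6
    · refine setIntegral_congr_fun measurableSet_Icc fun s hs => ?_
      have e : (X.heatConcat hm htt').M s ω = X.M s ω :=
        congrFun (heatThen_of_le hs.1 m X.M) ω
      simp only [e]
  have hi := hf.integrable_path_cost ht'T X
  have h := integral_mono (μ := X.P)
    (hf.integrable_path_cost (htt'.trans ht'T) (X.heatConcat hm htt'))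
    ((integrable_const ((t' - t) * K)).add hi) key
  refine h.trans (le_of_eq ?_)
  rw [integral_add' (integrable_const _) hi]
  simp [mvCost]

/-- One half of the dynamic programming principle, along the heat flow. -/
lemma gameValue_le (hf : IsRegularCost f C) {t' : ℝ} (htt' : t ≤ t') (ht'T : t' ≤ T)
    (hm : MemP d 2 m) :
    gameValue d f T t m ≤ (t' - t) * (hamiltonian f t m +
      C * (√(t' - t) * (∫ z, ‖z‖ ∂(ProbabilityTheory.stdGaussian (Ed d))) + (t' - t))) +
      gameValue d f T t' (heatFlow d t t' m) := by
  rw [← sub_le_iff_le_add']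
  obtain ⟨X₀⟩ := MVP.nonempty ht'T (hm.heatFlow htt')
  refine le_csInf ⟨_, X₀, rfl⟩ ?_
  rintro _ ⟨X, rfl⟩
  rw [sub_le_iff_le_add']
  exact (csInf_le (hf.bddBelow_mvCost (htt'.trans ht'T) m) ⟨X.heatConcat hm htt', rfl⟩).trans
    (hf.mvCost_heatConcat_le htt' ht'T hm X)

end IsRegularCost

lemma integral_bilin_stdGaussian {d : ℕ} (B : Ed d →L[ℝ] Ed d →L[ℝ] ℝ) :
    ∫ z, B z z ∂(ProbabilityTheory.stdGaussian (Ed d)) =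
      ∑ i, B (EuclideanSpace.single i 1) (EuclideanSpace.single i 1) := by
  have h2 : MemLp (id : Ed d → Ed d) 2 (ProbabilityTheory.stdGaussian (Ed d)) := by
    simpa using ProbabilityTheory.IsGaussian.memLp_id (ProbabilityTheory.stdGaussian (Ed d)) 2
      (by simp)
  let a : Fin d → Ed d := fun i =>
    (InnerProductSpace.toDual ℝ (Ed d)).symm (B.flip (EuclideanSpace.single i 1))
  have ha : ∀ i z, inner ℝ (a i) z = B z (EuclideanSpace.single i 1) := fun i z => by
    simp [a]
  have hB : ∀ z, B z z = ∑ i, inner ℝ (EuclideanSpace.single i (1 : ℝ)) z * inner ℝ (a i) z := by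
    intro z
    have hz : z = ∑ i, z i • EuclideanSpace.single i (1 : ℝ) := by
      simpa using ((EuclideanSpace.basisFun (Fin d) ℝ).sum_repr z).symm
    conv_lhs => rw [show B z z = B z (∑ i, z i • EuclideanSpace.single i (1 : ℝ)) by rw [← hz]]
    simp [ha, map_sum, EuclideanSpace.inner_single_left]
  have hint : ∀ x y : Ed d, Integrable (fun z => inner ℝ x z * inner ℝ y z)
      (ProbabilityTheory.stdGaussian (Ed d)) := fun x y =>
    (h2.const_inner x).integrable_mul (h2.const_inner y)
  rw [integral_congr_ae (ae_of_all _ hB), integral_finsetSum _ fun i _ => hint _ _]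
  refine Finset.sum_congr rfl fun i _ => ?_
  have h := ProbabilityTheory.covarianceBilin_apply h2 (EuclideanSpace.single i (1 : ℝ)) (a i)
  simp only [id, ProbabilityTheory.integral_id_stdGaussian, sub_zero,
    ProbabilityTheory.covarianceBilin_stdGaussian] at h
  exact h.symm.trans ((real_inner_comm _ _).trans (ha i _))

lemma integral_iteratedFDeriv_stdGaussian {d : ℕ} (ζ : Ed d → ℝ) (x : Ed d) :
    ∫ z, iteratedFDeriv ℝ 2 ζ x (fun _ => z) ∂(ProbabilityTheory.stdGaussian (Ed d)) =
      lapl d ζ x := by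
  simp only [lapl, iteratedFDeriv_two_apply]
  exact integral_bilin_stdGaussian _

/-- Second order Taylor expansion with Lagrange remainder. -/
lemma exists_taylor_two {d : ℕ} {ζ : Ed d → ℝ} (hζ : ContDiff ℝ 2 ζ) (x y : Ed d) :
    ∃ θ ∈ Ioo (0 : ℝ) 1, ζ (x + y) - ζ x - fderiv ℝ ζ x y =
      iteratedFDeriv ℝ 2 ζ (x + θ • y) (fun _ => y) / 2 := by
  have hd : Differentiable ℝ ζ := hζ.differentiable (by simp)
  have hd' : Differentiable ℝ (fderiv ℝ ζ) :=
    (hζ.fderiv_right (m := 1) (by norm_num)).differentiable (by simp)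
  have hl : ∀ a : ℝ, HasDerivAt (fun a : ℝ => x + a • y) y a := fun a => by
    simpa using ((hasDerivAt_id a).smul_const y).const_add x
  have h1 : ∀ a : ℝ, HasDerivAt (fun a : ℝ => ζ (x + a • y)) (fderiv ℝ ζ (x + a • y) y) a :=
    fun a => (hd _).hasFDerivAt.comp_hasDerivAt a (hl a)
  have h2 : ∀ a : ℝ, HasDerivAt (fun a : ℝ => fderiv ℝ ζ (x + a • y) y)
      (fderiv ℝ (fderiv ℝ ζ) (x + a • y) y y) a := fun a => by
    simpa using ((hd' _).hasFDerivAt.comp_hasDerivAt a (hl a)).clm_apply (hasDerivAt_const a y)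
  have h3 : ∀ a : ℝ, HasDerivAt (fun a : ℝ => ζ (x + a • y) - a * fderiv ℝ ζ x y)
      (fderiv ℝ ζ (x + a • y) y - fderiv ℝ ζ x y) a := fun a => by
    have h := (h1 a).sub ((hasDerivAt_id a).mul_const (fderiv ℝ ζ x y))
    rw [one_mul] at h
    exact h
  have h4 : ∀ a : ℝ, HasDerivAt (fun a : ℝ => a ^ 2) (2 * a) a := fun a => by
    simpa using hasDerivAt_pow 2 a
  obtain ⟨b, hb, hb'⟩ := exists_ratio_hasDerivAt_eq_ratio_slope _ _ (zero_lt_one' ℝ)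
    (fun a _ => (h3 a).continuousAt.continuousWithinAt) (fun a _ => h3 a) _ _
    (fun a _ => (h4 a).continuousAt.continuousWithinAt) (fun a _ => h4 a)
  obtain ⟨θ, hθ, hθ'⟩ := exists_hasDerivAt_eq_slope _ _ hb.1
    (fun a _ => (h2 a).continuousAt.continuousWithinAt) (fun a _ => h2 a)
  refine ⟨θ, ⟨hθ.1, hθ.2.trans hb.2⟩, ?_⟩
  rw [iteratedFDeriv_two_apply, hθ']
  have := hb.1.ne'
  simp only [one_smul, zero_smul, add_zero, one_mul, zero_mul, sub_zero, one_pow] at hb' ⊢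
  field_simp
  norm_num at hb'
  linarith

/-- `ζ` is of class `C²` and, with its first two derivatives, has quadratic growth. -/
structure IsC2QuadGrowth {d : ℕ} (ζ : Ed d → ℝ) (c : ℝ) : Prop where
  smooth : ContDiff ℝ 2 ζ
  abs_le : ∀ x, |ζ x| ≤ c * (1 + ‖x‖ ^ 2)
  norm_fderiv_le : ∀ x, ‖fderiv ℝ ζ x‖ ≤ c * (1 + ‖x‖ ^ 2)
  norm_iteratedFDeriv_le : ∀ x, ‖iteratedFDeriv ℝ 2 ζ x‖ ≤ c * (1 + ‖x‖ ^ 2)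

namespace IsC2QuadGrowth

variable {d : ℕ} {ζ : Ed d → ℝ} {c : ℝ}

lemma nonneg (hζ : IsC2QuadGrowth ζ c) : 0 ≤ c := by
  simpa using (abs_nonneg _).trans (hζ.abs_le 0)

lemma integrable (hζ : IsC2QuadGrowth ζ c) {m : Measure (Ed d)} (hm : MemP d 2 m) :
    Integrable ζ m := by
  have := hm.1
  have hi : Integrable (fun x => c * (1 + ‖x‖ ^ (2 : ℝ))) m :=
    ((integrable_const 1).add hm.2).const_mul c
  refine hi.mono' hζ.smooth.continuous.aestronglyMeasurable (ae_of_all _ fun x => ?_)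
  simpa using hζ.abs_le x

lemma continuous_fderiv (hζ : IsC2QuadGrowth ζ c) : Continuous (fderiv ℝ ζ) :=
  hζ.smooth.continuous_fderiv (by simp)

lemma continuous_iteratedFDeriv (hζ : IsC2QuadGrowth ζ c) :
    Continuous (iteratedFDeriv ℝ 2 ζ) :=
  hζ.smooth.continuous_iteratedFDeriv (by simp)

lemma integrable_fderiv (hζ : IsC2QuadGrowth ζ c) {m : Measure (Ed d)} (hm : MemP d 2 m) :
    Integrable (fun q : Ed d × Ed d => fderiv ℝ ζ q.1 q.2)
      (m.prod (ProbabilityTheory.stdGaussian (Ed d))) := by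
  have := hm.1
  have hi : Integrable (fun x => c * (1 + ‖x‖ ^ (2 : ℝ))) m :=
    ((integrable_const 1).add hm.2).const_mul c
  have h1 := hi.mul_prod (integrable_norm_pow_stdGaussian d 1)
  have hc := hζ.continuous_fderiv
  refine h1.mono' (Continuous.aestronglyMeasurable (by fun_prop)) (ae_of_all _ fun q => ?_)
  refine ((fderiv ℝ ζ q.1).le_opNorm q.2).trans ?_
  simpa using mul_le_mul_of_nonneg_right (hζ.norm_fderiv_le q.1) (norm_nonneg q.2)

lemma integral_fderiv (hζ : IsC2QuadGrowth ζ c) {m : Measure (Ed d)} (hm : MemP d 2 m) :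
    ∫ q : Ed d × Ed d, fderiv ℝ ζ q.1 q.2 ∂(m.prod (ProbabilityTheory.stdGaussian (Ed d))) =
      0 := by
  have := hm.1
  rw [integral_prod _ (hζ.integrable_fderiv hm)]
  simp [ProbabilityTheory.integral_strongDual_stdGaussian]

lemma norm_iteratedFDeriv_apply_le (hζ : IsC2QuadGrowth ζ c) (x z : Ed d) :
    |iteratedFDeriv ℝ 2 ζ x fun _ => z| ≤ c * (1 + ‖x‖ ^ 2) * ‖z‖ ^ 2 := by
  have h := (iteratedFDeriv ℝ 2 ζ x).le_opNorm fun _ => z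
  simp only [Real.norm_eq_abs, Finset.prod_const, Finset.card_univ, Fintype.card_fin] at h
  exact h.trans (mul_le_mul_of_nonneg_right (hζ.norm_iteratedFDeriv_le x) (by positivity))

/-- The second order Taylor remainder along the heat flow. -/
lemma heatFlow_quotient_eq (hζ : IsC2QuadGrowth ζ c) {m : Measure (Ed d)} (hm : MemP d 2 m)
    (t : ℝ) {h : ℝ} (hh : 0 < h) :
    ((∫ x, ζ x ∂(heatFlow d t (t + h) m)) - ∫ x, ζ x ∂m) / h =
      ∫ q : Ed d × Ed d, (ζ (q.1 + √h • q.2) - ζ q.1 - fderiv ℝ ζ q.1 (√h • q.2)) / h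
        ∂(m.prod (ProbabilityTheory.stdGaussian (Ed d))) := by
  have := hm.1
  have hle : t ≤ t + h := by linarith
  have hc := hζ.smooth.continuous
  have hi := hζ.integrable (hm.heatFlow hle)
  rw [heatFlow_eq_map d hle, add_sub_cancel_left] at *
  replace hi : Integrable (fun q : Ed d × Ed d => ζ (q.1 + √h • q.2))
      (m.prod (ProbabilityTheory.stdGaussian (Ed d))) :=
    (integrable_map_measure hc.aestronglyMeasurable (by fun_prop)).1 hi
  rw [integral_map (by fun_prop) hc.aestronglyMeasurable]
  have h1 := (hζ.integrable hm).comp_fst (ProbabilityTheory.stdGaussian (Ed d))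
  have h2 := (hζ.integrable_fderiv hm).const_mul √h
  simp only [map_smul, smul_eq_mul]
  rw [integral_div, integral_sub (by exact hi.sub h1) h2, integral_sub hi h1, integral_const_mul,
    hζ.integral_fderiv hm, integral_fun_fst]
  simp

end IsC2QuadGrowth

/-- The generator of the heat flow, for a converging family of integrands. -/
lemma tendsto_heatFlow_quotient {d : ℕ} {m : Measure (Ed d)} (hm : MemP d 2 m) (t : ℝ)
    {ζ : ℝ → Ed d → ℝ} {ζ₀ : Ed d → ℝ} {c : ℝ} (hζ : ∀ᶠ h in 𝓝[>] 0, IsC2QuadGrowth (ζ h) c)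
    (hζ₀ : IsC2QuadGrowth ζ₀ c)
    (hlim : ∀ x, Tendsto (fun p : ℝ × Ed d => iteratedFDeriv ℝ 2 (ζ p.1) p.2)
      (𝓝[>] 0 ×ˢ 𝓝 x) (𝓝 (iteratedFDeriv ℝ 2 ζ₀ x))) :
    Tendsto (fun h => ((∫ x, ζ h x ∂(heatFlow d t (t + h) m)) - ∫ x, ζ h x ∂m) / h) (𝓝[>] 0)
      (𝓝 (1 / 2 * ∫ x, lapl d ζ₀ x ∂m)) := by
  have := hm.1
  have hc := hζ₀.nonneg
  let R : ℝ → Ed d × Ed d → ℝ := fun h q =>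
    (ζ h (q.1 + √h • q.2) - ζ h q.1 - fderiv ℝ (ζ h) q.1 (√h • q.2)) / h
  have hR : ∀ h q, 0 < h → IsC2QuadGrowth (ζ h) c → ∃ θ ∈ Ioo (0 : ℝ) 1,
      R h q = iteratedFDeriv ℝ 2 (ζ h) (q.1 + (θ * √h) • q.2) (fun _ => q.2) / 2 := by
    intro h q hh hζh
    obtain ⟨θ, hθ, e⟩ := exists_taylor_two hζh.smooth q.1 (√h • q.2)
    refine ⟨θ, hθ, ?_⟩
    simp only [R, e, mul_smul]
    have := (iteratedFDeriv ℝ 2 (ζ h) (q.1 + θ • √h • q.2)).map_smul_univ (fun _ => √h)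
      (fun _ => q.2)
    rw [this]
    simp only [Finset.prod_const, Finset.card_univ, Fintype.card_fin, Real.sq_sqrt hh.le,
      smul_eq_mul]
    field_simp
  have hbound : ∀ h q, h ∈ Ioo (0 : ℝ) 1 → IsC2QuadGrowth (ζ h) c →
      ‖R h q‖ ≤ c * (1 + 2 * ‖q.1‖ ^ (2 : ℝ)) * ‖q.2‖ ^ 2 + c * 2 * ‖q.2‖ ^ 4 := by
    intro h q hh hζh
    obtain ⟨θ, hθ, e⟩ := hR h q hh.1 hζh
    have h1 := hζh.norm_iteratedFDeriv_apply_le (q.1 + (θ * √h) • q.2) q.2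
    have h2 : ‖q.1 + (θ * √h) • q.2‖ ≤ ‖q.1‖ + ‖q.2‖ := by
      refine (norm_add_le _ _).trans (add_le_add_right ?_ _)
      rw [norm_smul, Real.norm_of_nonneg (mul_nonneg hθ.1.le (Real.sqrt_nonneg _))]
      refine mul_le_of_le_one_left (norm_nonneg _) ?_
      exact mul_le_one₀ hθ.2.le (Real.sqrt_nonneg _) (Real.sqrt_le_one.2 hh.2.le)
    have h3 : ‖q.1 + (θ * √h) • q.2‖ ^ 2 ≤ 2 * ‖q.1‖ ^ 2 + 2 * ‖q.2‖ ^ 2 := by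
      nlinarith [sq_nonneg (‖q.1‖ - ‖q.2‖), norm_nonneg (q.1 + (θ * √h) • q.2)]
    have h4 : c * (1 + ‖q.1 + (θ * √h) • q.2‖ ^ 2) * ‖q.2‖ ^ 2 ≤
        c * (1 + (2 * ‖q.1‖ ^ 2 + 2 * ‖q.2‖ ^ 2)) * ‖q.2‖ ^ 2 := by gcongr
    rw [e, Real.norm_eq_abs, abs_div, abs_two, Real.rpow_two]
    have h5 := abs_nonneg ((iteratedFDeriv ℝ 2 (ζ h) (q.1 + (θ * √h) • q.2)) fun _ => q.2)
    nlinarith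
  have hI : Integrable (fun q : Ed d × Ed d => c * (1 + 2 * ‖q.1‖ ^ (2 : ℝ)) * ‖q.2‖ ^ 2 +
      c * 2 * ‖q.2‖ ^ 4) (m.prod (ProbabilityTheory.stdGaussian (Ed d))) :=
    ((((integrable_const 1).add (hm.2.const_mul 2)).const_mul c).mul_prod
      (integrable_norm_pow_stdGaussian d 2)).add
      (((integrable_norm_pow_stdGaussian d 4).const_mul (c * 2)).comp_snd m)
  have hpos : ∀ᶠ h : ℝ in 𝓝[>] 0, h ∈ Ioo (0 : ℝ) 1 := Ioo_mem_nhdsGT one_pos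
  have hint : Tendsto (fun h => ∫ q, R h q ∂(m.prod (ProbabilityTheory.stdGaussian (Ed d))))
      (𝓝[>] 0) (𝓝 (∫ q : Ed d × Ed d, iteratedFDeriv ℝ 2 ζ₀ q.1 (fun _ => q.2) / 2
        ∂(m.prod (ProbabilityTheory.stdGaussian (Ed d))))) := by
    refine tendsto_integral_filter_of_dominated_convergence _ ?_ ?_ hI ?_
    · filter_upwards [hζ] with h hζh
      have h1 := hζh.smooth.continuous
      have h2 := hζh.continuous_fderiv
      exact Continuous.aestronglyMeasurable (by fun_prop)
    · filter_upwards [hζ, hpos] with h hζh hh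
      exact ae_of_all _ fun q => hbound h q hh hζh
    · refine ae_of_all _ fun q => ?_
      choose! θ hθ hθ' using fun h (hh : 0 < h ∧ IsC2QuadGrowth (ζ h) c) => hR h q hh.1 hh.2
      have hev : ∀ᶠ h in 𝓝[>] 0, 0 < h ∧ IsC2QuadGrowth (ζ h) c :=
        (hpos.mono fun h hh => hh.1).and hζ
      have h0 : Tendsto (fun h => θ h * √h) (𝓝[>] 0) (𝓝 0) := by
        have h1 : Tendsto (fun h : ℝ => √h) (𝓝[>] 0) (𝓝 0) := by
          simpa using (Real.continuous_sqrt.tendsto 0).mono_left nhdsWithin_le_nhds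
        refine squeeze_zero' ?_ ?_ h1
        · filter_upwards [hev] with h hh
          exact mul_nonneg (hθ h hh).1.le (Real.sqrt_nonneg _)
        · filter_upwards [hev] with h hh
          exact mul_le_of_le_one_left (Real.sqrt_nonneg _) (hθ h hh).2.le
      have h1 : Tendsto (fun h => q.1 + (θ h * √h) • q.2) (𝓝[>] 0) (𝓝 q.1) := by
        simpa using (h0.smul_const q.2).const_add q.1
      have h2 := (hlim q.1).comp (tendsto_id.prodMk h1)
      have h3 := (((ContinuousMultilinearMap.apply ℝ (fun _ : Fin 2 => Ed d) ℝ
        (fun _ => q.2)).continuous.tendsto _).comp h2).div_const 2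
      refine Tendsto.congr' ?_ h3
      filter_upwards [hev] with h hh
      exact (hθ' h hh).symm
  have hlast : ∫ q : Ed d × Ed d, iteratedFDeriv ℝ 2 ζ₀ q.1 (fun _ => q.2) / 2
      ∂(m.prod (ProbabilityTheory.stdGaussian (Ed d))) = 1 / 2 * ∫ x, lapl d ζ₀ x ∂m := by
    have hcont : Continuous fun q : Ed d × Ed d => iteratedFDeriv ℝ 2 ζ₀ q.1 fun _ => q.2 := by
      have := hζ₀.continuous_iteratedFDeriv
      fun_prop
    have hi : Integrable (fun q : Ed d × Ed d => iteratedFDeriv ℝ 2 ζ₀ q.1 fun _ => q.2)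
        (m.prod (ProbabilityTheory.stdGaussian (Ed d))) := by
      have h1 := (((integrable_const (1 : ℝ)).add hm.2).const_mul c).mul_prod
        (integrable_norm_pow_stdGaussian d 2)
      refine h1.mono' hcont.aestronglyMeasurable (ae_of_all _ fun q => ?_)
      simpa using hζ₀.norm_iteratedFDeriv_apply_le q.1 q.2
    rw [integral_div, integral_prod _ hi]
    simp only [integral_iteratedFDeriv_stdGaussian]
    ring
  rw [← hlast]
  refine hint.congr' ?_
  filter_upwards [hζ, hpos] with h hζh hh
  exact (hζh.heatFlow_quotient_eq hm t hh.1).symm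

/-- A mean value inequality for right derivatives. -/
lemma exists_sub_le_of_right_deriv {g D : ℝ → ℝ} (hg : ContinuousOn g (Icc 0 1))
    (hD : ∀ r ∈ Ico (0 : ℝ) 1, Tendsto (slope g r) (𝓝[>] r) (𝓝 (D r))) {ε : ℝ} (hε : 0 < ε) :
    ∃ r ∈ Ico (0 : ℝ) 1, g 1 - g 0 ≤ ε + D r := by
  by_contra! hcon
  have h := image_le_of_liminf_slope_right_lt_deriv_boundary (f' := D) hg
    (fun x hx r hr => ((hD x hx).eventually_lt_const hr).frequently)
    (B := fun x => g 0 + x * (g 1 - g 0 - ε)) (B' := fun _ => g 1 - g 0 - ε) (by simp)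
    (fun x => by simpa using ((hasDerivAt_id x).mul_const (g 1 - g 0 - ε)).const_add (g 0))
    (fun x hx _ => by linarith [hcon x hx]) (right_mem_Icc.2 zero_le_one)
  simp only [one_mul] at h
  linarith

lemma wdist_two_mix_le_abs {d : ℕ} {m m' : Measure (Ed d)} (hm : MemP d 2 m) (hm' : MemP d 2 m')
    {γ : Measure (Ed d × Ed d)} [IsProbabilityMeasure γ] (hγ : IsCoupling d γ m m')
    (hi : Integrable (fun q => ‖q.1 - q.2‖ ^ (2 : ℝ)) γ) {r r' : ℝ} (hr : r ∈ Icc (0 : ℝ) 1)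
    (hr' : r' ∈ Icc (0 : ℝ) 1) :
    wdist d 2 (mix m m' r) (mix m m' r') ≤
      (|r' - r| * ∫ q, ‖q.1 - q.2‖ ^ (2 : ℝ) ∂γ) ^ (1 / (2 : ℝ)) := by
  have := hm.1
  have := hm'.1
  have := (hm.mix hm' hr).1
  have := (hm.mix hm' hr').1
  rcases le_total r r' with h | h
  · rw [abs_of_nonneg (sub_nonneg.2 h)]
    exact wdist_two_mix_le hγ hi hr.1 h hr'.2
  · rw [abs_sub_comm, abs_of_nonneg (sub_nonneg.2 h), wdist_comm]
    exact wdist_two_mix_le hγ hi hr'.1 h hr.2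

namespace TestFn

variable {d : ℕ} {T : ℝ}

lemma exists_isC2QuadGrowth (ψ : TestFn d T) : ∃ c : ℝ, ∀ t ∈ Ico 0 T, ∀ m : Measure (Ed d),
    MemP d 2 m → IsC2QuadGrowth (ψ.δφ t m) c := by
  obtain ⟨c, hc⟩ := ψ.quadGrowth
  exact ⟨c, fun t ht m hm => ⟨ψ.smoothX t ht m hm, fun x => (hc t ht m hm x).1,
    fun x => (hc t ht m hm x).2.1, fun x => (hc t ht m hm x).2.2⟩⟩

lemma continuousOn_mix (ψ : TestFn d T) {t : ℝ} (ht : t ∈ Icc 0 T) {m m' : Measure (Ed d)}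
    (hm : MemP d 2 m) (hm' : MemP d 2 m') {γ : Measure (Ed d × Ed d)} [IsProbabilityMeasure γ]
    (hγ : IsCoupling d γ m m') (hi : Integrable (fun q => ‖q.1 - q.2‖ ^ (2 : ℝ)) γ) :
    ContinuousOn (fun r => ψ.φ t (mix m m' r)) (Icc 0 1) := by
  intro r hr
  refine Metric.tendsto_nhds.2 fun ε hε => ?_
  obtain ⟨η, hη, h⟩ := ψ.d2cont t ht _ (hm.mix hm' hr) ε hε
  have hlim : Tendsto (fun r' => (|r' - r| * ∫ q, ‖q.1 - q.2‖ ^ (2 : ℝ) ∂γ) ^ (1 / (2 : ℝ)))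
      (𝓝[Icc 0 1] r) (𝓝 0) := by
    have hc : Continuous fun r' : ℝ =>
        (|r' - r| * ∫ q, ‖q.1 - q.2‖ ^ (2 : ℝ) ∂γ) ^ (1 / (2 : ℝ)) :=
      Continuous.rpow_const (by fun_prop) fun _ => Or.inr (by norm_num)
    simpa using (hc.tendsto r).mono_left nhdsWithin_le_nhds
  filter_upwards [hlim.eventually_lt_const hη, self_mem_nhdsWithin] with r' h1 hr'
  rw [Real.dist_eq]
  exact h t ht _ (hm.mix hm' hr') (by simpa using hη)
    ((wdist_two_mix_le_abs hm hm' hγ hi hr hr').trans_lt h1)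

lemma tendsto_slope_mix (ψ : TestFn d T) {t : ℝ} (ht : t ∈ Ico 0 T) {m m' : Measure (Ed d)}
    (hm : MemP d 2 m) (hm' : MemP d 2 m') {r : ℝ} (hr : r ∈ Ico (0 : ℝ) 1) :
    Tendsto (slope (fun r => ψ.φ t (mix m m' r)) r) (𝓝[>] r)
      (𝓝 ((∫ x, ψ.δφ t (mix m m' r) x ∂m') - ∫ x, ψ.δφ t (mix m m' r) x ∂m)) := by
  obtain ⟨c, hc⟩ := ψ.exists_isC2QuadGrowth
  have hr1 : 0 < 1 - r := sub_pos.2 hr.2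
  have hrI : r ∈ Icc (0 : ℝ) 1 := ⟨hr.1, hr.2.le⟩
  have hμ := hm.mix hm' hrI
  have hg := hc t ht _ hμ
  have h0 := ψ.normalized t ht _ hμ
  rw [integral_mix hrI (hg.integrable hm) (hg.integrable hm')] at h0
  have hlim : (∫ x, ψ.δφ t (mix m m' r) x ∂m') - ∫ x, ψ.δφ t (mix m m' r) x ∂m =
      (∫ x, ψ.δφ t (mix m m' r) x ∂m') / (1 - r) := by
    rw [eq_div_iff hr1.ne']
    linarith
  rw [hlim]
  have hs : Tendsto (fun z => (z - r) / (1 - r)) (𝓝[>] r) (𝓝[>] 0) := by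
    refine tendsto_nhdsWithin_iff.2 ⟨?_, ?_⟩
    · have hcont : Continuous fun z : ℝ => (z - r) / (1 - r) := by fun_prop
      simpa using (hcont.tendsto r).mono_left nhdsWithin_le_nhds
    · filter_upwards [self_mem_nhdsWithin] with z hz
      exact div_pos (sub_pos.2 hz) hr1
  refine (((ψ.measDeriv t ht _ hμ m' hm').comp hs).div_const (1 - r)).congr' ?_
  filter_upwards [Ioo_mem_nhdsGT hr.2] with z hz
  have hsI : (z - r) / (1 - r) ∈ Icc (0 : ℝ) 1 :=
    ⟨div_nonneg (sub_nonneg.2 hz.1.le) hr1.le, (div_le_one hr1).2 (by linarith [hz.2])⟩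
  have hmm := mix_mix m m' hrI hsI
  rw [div_mul_cancel₀ _ hr1.ne', add_sub_cancel] at hmm
  have hz' : z - r ≠ 0 := (sub_pos.2 hz.1).ne'
  have e : ψ.φ t ((1 - ENNReal.ofReal ((z - r) / (1 - r))) • mix m m' r +
      ENNReal.ofReal ((z - r) / (1 - r)) • m') = ψ.φ t (mix m m' z) := congrArg _ hmm
  rw [slope_def_field, Function.comp_apply, e]
  field_simp

lemma exists_sub_le_mix (ψ : TestFn d T) {t : ℝ} (ht : t ∈ Ico 0 T) {m m' : Measure (Ed d)}
    (hm : MemP d 2 m) (hm' : MemP d 2 m') {γ : Measure (Ed d × Ed d)} [IsProbabilityMeasure γ]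
    (hγ : IsCoupling d γ m m') (hi : Integrable (fun q => ‖q.1 - q.2‖ ^ (2 : ℝ)) γ) {ε : ℝ}
    (hε : 0 < ε) : ∃ r ∈ Ico (0 : ℝ) 1, ψ.φ t m' - ψ.φ t m ≤
      ε + ((∫ x, ψ.δφ t (mix m m' r) x ∂m') - ∫ x, ψ.δφ t (mix m m' r) x ∂m) := by
  have h := exists_sub_le_of_right_deriv
    (ψ.continuousOn_mix ⟨ht.1, ht.2.le⟩ hm hm' hγ hi)
    (fun r hr => ψ.tendsto_slope_mix ht hm hm' hr) hε
  simpa only [mix_one, mix_zero] using h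

end TestFn

lemma isCoupling_heatFlow (d : ℕ) {t s : ℝ} (hs : t ≤ s) (m : Measure (Ed d)) [SFinite m] :
    IsCoupling d (heatCoupling d m 0 √(s - t)) m (heatFlow d t s m) := by
  simpa [heatFlow_self] using isCoupling_heatCoupling d le_rfl hs m

/-- The distance from `m` to its mixtures with the heat flow, uniformly in the mixture. -/
lemma wdist_two_mix_heatFlow_le {d : ℕ} {m : Measure (Ed d)} (hm : MemP d 2 m) (t : ℝ) {h r : ℝ}
    (hh : 0 ≤ h) (hr : r ∈ Icc (0 : ℝ) 1) :
    wdist d 2 m (mix m (heatFlow d t (t + h) m) r) ≤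
      (h * ∫ z, ‖z‖ ^ (2 : ℝ) ∂(ProbabilityTheory.stdGaussian (Ed d))) ^ (1 / (2 : ℝ)) := by
  have := hm.1
  have hle : t ≤ t + h := by linarith
  have h1 := wdist_two_mix_le_abs hm (hm.heatFlow hle) (isCoupling_heatFlow d hle m)
    (integrable_heatCoupling d m _ _) (left_mem_Icc.2 zero_le_one) hr
  rw [mix_zero] at h1
  have hK : 0 ≤ ∫ z, ‖z‖ ^ (2 : ℝ) ∂(ProbabilityTheory.stdGaussian (Ed d)) :=
    integral_nonneg fun z => by positivity
  refine h1.trans ?_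
  rw [integral_heatCoupling, zero_sub, abs_neg, abs_of_nonneg (Real.sqrt_nonneg _), Real.rpow_two,
    add_sub_cancel_left, Real.sq_sqrt hh, sub_zero, abs_of_nonneg hr.1]
  refine Real.rpow_le_rpow (by have := hr.1; positivity) ?_ (by norm_num)
  exact mul_le_of_le_one_left (by positivity) hr.2

lemma tendsto_wdist_mix_heatFlow {d : ℕ} {m : Measure (Ed d)} (hm : MemP d 2 m) (t : ℝ)
    {r : ℝ → ℝ} (hr : ∀ᶠ h in 𝓝[>] 0, r h ∈ Icc (0 : ℝ) 1) :
    Tendsto (fun h => wdist d 2 m (mix m (heatFlow d t (t + h) m) (r h))) (𝓝[>] 0) (𝓝 0) := by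
  have hlim : Tendsto (fun h : ℝ => (h * ∫ z, ‖z‖ ^ (2 : ℝ)
      ∂(ProbabilityTheory.stdGaussian (Ed d))) ^ (1 / (2 : ℝ))) (𝓝[>] 0) (𝓝 0) := by
    have hc : Continuous fun h : ℝ => (h * ∫ z, ‖z‖ ^ (2 : ℝ)
        ∂(ProbabilityTheory.stdGaussian (Ed d))) ^ (1 / (2 : ℝ)) :=
      Continuous.rpow_const (by fun_prop) fun _ => Or.inr (by norm_num)
    simpa using (hc.tendsto 0).mono_left nhdsWithin_le_nhds
  refine squeeze_zero' (Eventually.of_forall fun h => wdist_nonneg _ _ _ _) ?_ hlim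
  filter_upwards [hr, self_mem_nhdsWithin] with h h1 h2
  exact wdist_two_mix_heatFlow_le hm t (le_of_lt h2) h1

namespace TestFn

variable {d : ℕ} {T : ℝ}

/-- An upper bound for the increment of a test function along the heat flow, whose quotient by
the time step converges to the image by the generator. -/
lemma exists_heatFlow_bound (ψ : TestFn d T) {t : ℝ} (ht : t ∈ Ico 0 T) {m : Measure (Ed d)}
    (hm : MemP d 2 m) : ∃ G : ℝ → ℝ,
      (∀ᶠ h in 𝓝[>] 0, (ψ.φ t (heatFlow d t (t + h) m) - ψ.φ t m) / h ≤ G h) ∧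
      Tendsto G (𝓝[>] 0) (𝓝 (1 / 2 * ∫ x, lapl d (ψ.δφ t m) x ∂m)) := by
  have := hm.1
  obtain ⟨c, hc⟩ := ψ.exists_isC2QuadGrowth
  have key : ∀ h : ℝ, 0 < h → ∃ r ∈ Ico (0 : ℝ) 1,
      ψ.φ t (heatFlow d t (t + h) m) - ψ.φ t m ≤ h ^ 2 +
        ((∫ x, ψ.δφ t (mix m (heatFlow d t (t + h) m) r) x ∂(heatFlow d t (t + h) m)) -
          ∫ x, ψ.δφ t (mix m (heatFlow d t (t + h) m) r) x ∂m) := fun h hh =>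
    ψ.exists_sub_le_mix ht hm (hm.heatFlow (by linarith)) (isCoupling_heatFlow d (by linarith) m)
      (integrable_heatCoupling d m _ _) (by positivity)
  choose! r hr hr' using key
  have hpos : ∀ᶠ h : ℝ in 𝓝[>] 0, 0 < h := self_mem_nhdsWithin
  have hrI : ∀ᶠ h in 𝓝[>] 0, r h ∈ Icc (0 : ℝ) 1 :=
    hpos.mono fun h hh => ⟨(hr h hh).1, (hr h hh).2.le⟩
  have hmem : ∀ᶠ h in 𝓝[>] 0, MemP d 2 (mix m (heatFlow d t (t + h) m) (r h)) := by
    filter_upwards [hpos, hrI] with h hh hrh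
    exact hm.mix (hm.heatFlow (by linarith)) hrh
  refine ⟨fun h => h + ((∫ x, ψ.δφ t (mix m (heatFlow d t (t + h) m) (r h)) x
    ∂(heatFlow d t (t + h) m)) - ∫ x, ψ.δφ t (mix m (heatFlow d t (t + h) m) (r h)) x ∂m) / h,
    ?_, ?_⟩
  · filter_upwards [hpos] with h hh
    rw [div_le_iff₀ hh, add_mul, div_mul_cancel₀ _ hh.ne', ← sq]
    exact hr' h hh
  · have h1 := tendsto_heatFlow_quotient
      (ζ := fun h => ψ.δφ t (mix m (heatFlow d t (t + h) m) (r h)))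
      (ζ₀ := ψ.δφ t m) hm t (hmem.mono fun h hh => hc t ht _ hh) (hc t ht m hm) ?_
    · have h0 : Tendsto (fun h : ℝ => h) (𝓝[>] 0) (𝓝 0) := tendsto_id.mono_left nhdsWithin_le_nhds
      simpa using h0.add h1
    · refine fun x => Metric.tendsto_nhds.2 fun ε hε => ?_
      obtain ⟨η, hη, hη'⟩ := ψ.d2contDeriv t ht m hm x ε hε
      have h2 := (tendsto_wdist_mix_heatFlow hm t hrI).eventually_lt_const hη
      filter_upwards [(hmem.and h2).prod_mk (Metric.ball_mem_nhds x hη)] with p hp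
      rw [dist_eq_norm]
      exact (hη' t ht _ hp.1.1 p.2 (by simpa using hη) hp.1.2
        (by simpa [dist_eq_norm] using hp.2)).2.2.2

lemma tendsto_time_quotient (ψ : TestFn d T) {t : ℝ} (ht : t ∈ Ico 0 T) {m : Measure (Ed d)}
    (hm : MemP d 2 m) :
    Tendsto (fun h => (ψ.φ (t + h) (heatFlow d t (t + h) m) -
      ψ.φ t (heatFlow d t (t + h) m)) / h) (𝓝[>] 0) (𝓝 (ψ.φt t m)) := by
  have hT : 0 < T - t := sub_pos.2 ht.2
  have hI : ∀ᶠ h : ℝ in 𝓝[>] 0, h ∈ Ioo 0 (T - t) := Ioo_mem_nhdsGT hT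
  have hw : Tendsto (fun h => wdist d 2 m (heatFlow d t (t + h) m)) (𝓝[>] 0) (𝓝 0) := by
    simpa only [mix_one] using tendsto_wdist_mix_heatFlow hm t (r := fun _ => 1)
      (Eventually.of_forall fun _ => right_mem_Icc.2 zero_le_one)
  refine Metric.tendsto_nhds.2 fun ε hε => ?_
  obtain ⟨η, hη, hη'⟩ := ψ.d2contDeriv t ht m hm 0 ε hε
  have hs : ∀ᶠ h : ℝ in 𝓝[>] 0, h ∈ Ioo 0 η := Ioo_mem_nhdsGT hη
  filter_upwards [hI, hs, hw.eventually_lt_const hη] with h h1 h2 h3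
  have hmh : MemP d 2 (heatFlow d t (t + h) m) := hm.heatFlow (by linarith [h1.1])
  have hd : ∀ s ∈ Icc t (t + h), HasDerivWithinAt (fun s => ψ.φ s (heatFlow d t (t + h) m))
      (ψ.φt s (heatFlow d t (t + h) m)) (Icc 0 T) s := fun s hs =>
    ψ.timeDeriv _ hmh s ⟨ht.1.trans hs.1, by linarith [hs.2, h1.2]⟩
  have hsub : Icc t (t + h) ⊆ Icc 0 T := Icc_subset_Icc ht.1 (by linarith [h1.2])
  obtain ⟨τ, hτ, e⟩ := exists_hasDerivAt_eq_slope (fun s => ψ.φ s (heatFlow d t (t + h) m))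
    (fun s => ψ.φt s (heatFlow d t (t + h) m)) (show t < t + h by linarith [h1.1])
    (fun s hs => ((hd s hs).continuousWithinAt).mono hsub)
    (fun s hs => (hd s (Ioo_subset_Icc_self hs)).hasDerivAt
      (Icc_mem_nhds (by linarith [hs.1, ht.1]) (by linarith [hs.2, h1.2])))
  rw [add_sub_cancel_left] at e
  rw [← e, Real.dist_eq]
  exact (hη' τ ⟨by linarith [hτ.1, ht.1], by linarith [hτ.2, h1.2]⟩ _ hmh 0
    (abs_lt.2 ⟨by linarith [hτ.1], by linarith [hτ.2, h2.2]⟩) h3 (by simpa using hη)).1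

end TestFn

lemma IsRegularCost.isSubsolution {d : ℕ} {T : ℝ}
    {A B : Type} [MetricSpace A] [CompactSpace A] [Nonempty A]
    [MetricSpace B] [CompactSpace B] [Nonempty B]
    {f : ℝ → Ed d → A → B → ℝ} {C : ℝ} (hf : IsRegularCost f C) :
    IsSubsolution d T (hamiltonian f) (fun t m => gameValue d f T t m) := by
  intro t ht m hm ψ ⟨η, hη, hmin⟩
  have := hm.1
  obtain ⟨G, hG, hGlim⟩ := ψ.exists_heatFlow_bound ht hm
  set K := ∫ z, ‖z‖ ∂(ProbabilityTheory.stdGaussian (Ed d))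
  have hlim := ((ψ.tendsto_time_quotient ht hm).add hGlim).add
    (show Tendsto (fun h : ℝ => hamiltonian f t m + C * (√h * K + h)) (𝓝[>] 0)
      (𝓝 (hamiltonian f t m)) by
        have hc : Continuous fun h : ℝ => hamiltonian f t m + C * (√h * K + h) := by fun_prop
        simpa using (hc.tendsto 0).mono_left nhdsWithin_le_nhds)
  refine ge_of_tendsto hlim ?_
  have hw : Tendsto (fun h : ℝ => √h * K) (𝓝[>] 0) (𝓝 0) := by
    have hc : Continuous fun h : ℝ => √h * K := by fun_prop
    simpa using (hc.tendsto 0).mono_left nhdsWithin_le_nhds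
  have hI : ∀ᶠ h : ℝ in 𝓝[>] 0, h ∈ Ioo 0 (T - t) := Ioo_mem_nhdsGT (sub_pos.2 ht.2)
  have hs : ∀ᶠ h : ℝ in 𝓝[>] 0, h ∈ Ioo 0 η := Ioo_mem_nhdsGT hη
  filter_upwards [hG, hI, hs, hw.eventually_lt_const hη] with h h1 h2 h3 h4
  have hle : t ≤ t + h := by linarith [h2.1]
  have h5 := wdist_one_heatFlow_le d le_rfl hle m
  rw [heatFlow_self, sub_self, Real.sqrt_zero, zero_sub, abs_neg, add_sub_cancel_left,
    abs_of_nonneg (Real.sqrt_nonneg _)] at h5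
  have h6 := hmin (t + h) ⟨by linarith [ht.1], by linarith [h2.2]⟩ _ (hm.heatFlow hle)
    (by rw [add_sub_cancel_left, abs_of_pos h2.1]; exact h3.2.le) (h5.trans h4.le)
  have h7 := hf.gameValue_le hle (show t + h ≤ T by linarith [h2.2]) hm
  rw [add_sub_cancel_left] at h7
  have h8 : 0 ≤ (ψ.φ (t + h) (heatFlow d t (t + h) m) - ψ.φ t (heatFlow d t (t + h) m)) / h +
      (ψ.φ t (heatFlow d t (t + h) m) - ψ.φ t m) / h +
      (hamiltonian f t m + C * (√h * K + h)) := by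
    have h9 : 0 ≤ ((ψ.φ (t + h) (heatFlow d t (t + h) m) - ψ.φ t (heatFlow d t (t + h) m)) +
        (ψ.φ t (heatFlow d t (t + h) m) - ψ.φ t m) +
        h * (hamiltonian f t m + C * (√h * K + h))) / h :=
      div_nonneg (by linarith) h2.1.le
    rwa [add_div, add_div, mul_div_cancel_left₀ _ h2.1.ne'] at h9
  linarith

/-- The value function `V(t,m) = inf_{M ∈ 𝓜(t,m)} E[∫_t^T H(s,M_s) ds]`
is a viscosity subsolution on `[0,T) × 𝒫₂` of the Hamilton–Jacobi equation
`∂_t U(t,m) + ½ ∫ div[D_m U](t,m,x) dm(x) + H(t,m) = 0`. -/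
theorem gameValue_is_subsolution (d : ℕ) (T : ℝ) (hT : 0 ≤ T)
    {A B : Type} [MetricSpace A] [CompactSpace A] [Nonempty A]
    [MetricSpace B] [CompactSpace B] [Nonempty B]
    (f : ℝ → Ed d → A → B → ℝ) (C : ℝ)
    (hfbdd : ∀ s x u v, |f s x u v| ≤ C)
    (hfcont : Continuous fun q : ℝ × Ed d × A × B => f q.1 q.2.1 q.2.2.1 q.2.2.2)
    (hflip : ∀ (u : A) (v : B), ∀ s s' : ℝ, ∀ x x' : Ed d,
      |f s x u v - f s' x' u v| ≤ C * (‖x - x'‖ + |s - s'|))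
    (hIsaacs : ∀ s ∈ Set.Icc 0 T, ∀ μ : Measure (Ed d), MemP d 2 μ →
      (⨅ u : A, ⨆ v : B, ∫ x, f s x u v ∂μ) = ⨆ v : B, ⨅ u : A, ∫ x, f s x u v ∂μ) :
    IsSubsolution d T (hamiltonian f) (fun t m => gameValue d f T t m) :=
  IsRegularCost.isSubsolution ⟨hfbdd, hfcont, hflip⟩

end
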